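/- arXiv:1412.4904 — 3 statements merged into one kernel-verified Lean document; each statement's English description precedes it below -/
import Mathlib

section
/- The Distributed Majority function DMAJ(x,y) = 1 iff Σᵢ₌₁ⁿ xᵢ·yᵢ ≥ n/2 (with x,y ∈ {0,1}ⁿ, x given to Alice and y to Bob) has garden-hose complexity O(n · log³ n). -/
/-- One step of the water's path in a garden-hose game: on even steps Alice's
matching (an involution on pipes together with the tap `none`) is applied,
on odd steps Bob's matching (an involution on the pipes). A fixed point of the
relevant involution means the corresponding pipe end is open (unmatched). -/
def ghStep {s : ℕ} (A : Option (Fin s) → Option (Fin s)) (B : Fin s → Fin s)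
    (n : ℕ) (v : Option (Fin s)) : Option (Fin s) :=
  if n % 2 = 0 then A v else Option.map B v

/-- Position of the water after `n` steps, starting at the tap `none`. -/
def ghWalk {s : ℕ} (A : Option (Fin s) → Option (Fin s)) (B : Fin s → Fin s) :
    ℕ → Option (Fin s)
  | 0 => none
  | n + 1 => ghStep A B n (ghWalk A B n)

/-- The length of the path starting at the tap: the first time the walk halts
(i.e. the current pipe end is open). Its parity is the output of the game. -/
noncomputable def ghLen {s : ℕ} (A : Option (Fin s) → Option (Fin s))
    (B : Fin s → Fin s) : ℕ :=
  sInf {n | ghStep A B n (ghWalk A B n) = ghWalk A B n}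

/-- A garden-hose protocol with `s` pipes: Alice places, depending on her input,
a matching (involution) on the pipes together with the tap `none`; Bob places a
matching on the pipes. -/
structure GHProtocol (X Y : Type) (s : ℕ) where
  A : X → Option (Fin s) → Option (Fin s)
  B : Y → Fin s → Fin s
  hA : ∀ x, Function.Involutive (A x)
  hB : ∀ y, Function.Involutive (B y)

/-- The protocol computes `f` if for every input the walk from the tap halts and
the parity of the path length is `f x y`. -/
def GHProtocol.Computes {X Y : Type} {s : ℕ} (P : GHProtocol X Y s)
    (f : X → Y → Bool) : Prop :=
  ∀ x y,
    {n | ghStep (P.A x) (P.B y) n (ghWalk (P.A x) (P.B y) n)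
        = ghWalk (P.A x) (P.B y) n}.Nonempty ∧
    (ghLen (P.A x) (P.B y) % 2 = 1 ↔ f x y = true)

/-- The garden-hose complexity of `f`. -/
noncomputable def GH {X Y : Type} (f : X → Y → Bool) : ℕ :=
  sInf {s | ∃ P : GHProtocol X Y s, P.Computes f}

/-- The Distributed Majority function: `DMAJ x y = 1` iff `Σᵢ xᵢ·yᵢ ≥ n/2`,
where Alice holds `x` and Bob holds `y`. -/
def DMAJ (n : ℕ) (x y : Fin n → Bool) : Bool :=
  decide (n ≤ 2 * (Finset.univ.filter fun i => x i = true ∧ y i = true).card)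

/-! ## Garden-hose protocols from partial injections -/

theorem exists_matching {U V : Type} (f : U → Option V)
    (hf : ∀ u u' v, f u = some v → f u' = some v → u = u') :
    ∃ g : U ⊕ V → U ⊕ V, Function.Involutive g ∧
      (∀ u, f u = none → g (Sum.inl u) = Sum.inl u) ∧
      (∀ u v, f u = some v → g (Sum.inl u) = Sum.inr v) := by
  classical
  let h : V → U ⊕ V := fun v => if hv : ∃ u, f u = some v then Sum.inl hv.choose else Sum.inr v
  have h1 : ∀ u v, f u = some v → h v = Sum.inl u := by
    intro u v huv
    have hv : ∃ u, f u = some v := ⟨u, huv⟩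
    simp only [h, dif_pos hv]
    rw [hf _ _ v hv.choose_spec huv]
  refine ⟨Sum.elim (fun u => match f u with | none => Sum.inl u | some v => Sum.inr v) h,
    ?_, ?_, ?_⟩
  · rintro (u | v)
    · rcases hu : f u with _ | v
      · simp [hu]
      · simp [hu, h1 u v hu]
    · by_cases hv : ∃ u, f u = some v
      · obtain ⟨u, hu⟩ := hv
        simp [h1 u v hu, hu]
      · simp [h, dif_neg hv]
  · intro u hu; simp [hu]
  · intro u v hu; simp [hu]

/-- The run of the water in a game given by partial injections. -/
inductive GRun {U D : Type} (fA : Option U → Option D) (fB : D → Option U) :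
    Option U ⊕ D → Bool → Prop
  | stopA (u : Option U) : fA u = none → GRun fA fB (Sum.inl u) false
  | stopB (d : D) : fB d = none → GRun fA fB (Sum.inr d) true
  | goA (u : Option U) (d : D) (r : Bool) : fA u = some d → GRun fA fB (Sum.inr d) r →
      GRun fA fB (Sum.inl u) r
  | goB (d : D) (u : U) (r : Bool) : fB d = some u → GRun fA fB (Sum.inl (some u)) r →
      GRun fA fB (Sum.inr d) r

/-- Regrouping of pipe ends on Alice's side. -/
def regroup (U D : Type) : Option (D ⊕ U) ≃ Option U ⊕ D where
  toFun := fun p => match p with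
    | none => Sum.inl none
    | some (Sum.inl d) => Sum.inr d
    | some (Sum.inr u) => Sum.inl (some u)
  invFun := fun p => match p with
    | Sum.inl none => none
    | Sum.inr d => some (Sum.inl d)
    | Sum.inl (some u) => some (Sum.inr u)
  left_inv := by rintro (_ | _ | _) <;> rfl
  right_inv := by rintro ((_ | _) | _) <;> rfl

theorem run_halts {U D : Type} {s : ℕ} (e : D ⊕ U ≃ Fin s)
    (fA : Option U → Option D) (fB : D → Option U)
    (A : Option (Fin s) → Option (Fin s)) (B : Fin s → Fin s)
    (pos : Option U ⊕ D → Option (Fin s)) (hpinj : Function.Injective pos)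
    (hpd : ∀ d, pos (Sum.inr d) = some (e (Sum.inl d)))
    (hpu : ∀ u, pos (Sum.inl (some u)) = some (e (Sum.inr u)))
    (hA0 : ∀ u, fA u = none → A (pos (Sum.inl u)) = pos (Sum.inl u))
    (hA1 : ∀ u d, fA u = some d → A (pos (Sum.inl u)) = pos (Sum.inr d))
    (hB0 : ∀ d, fB d = none → B (e (Sum.inl d)) = e (Sum.inl d))
    (hB1 : ∀ d u, fB d = some u → B (e (Sum.inl d)) = e (Sum.inr u))
    (p : Option U ⊕ D) (r : Bool) (h : GRun fA fB p r) :
    ∀ n, ghWalk A B n = pos p → (n % 2 = if p.isLeft then 0 else 1) →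
      (∀ m < n, ghStep A B m (ghWalk A B m) ≠ ghWalk A B m) →
      ∃ N, ghStep A B N (ghWalk A B N) = ghWalk A B N ∧
        (∀ m < N, ghStep A B m (ghWalk A B m) ≠ ghWalk A B m) ∧ (N % 2 = 1 ↔ r = true) := by
  induction h with
  | stopA u hu =>
    intro n hn hpar hlt
    refine ⟨n, ?_, hlt, ?_⟩
    · simp at hpar
      simp [ghStep, hpar, hn, hA0 u hu]
    · simp at hpar
      simp [hpar]
  | stopB d hd =>
    intro n hn hpar hlt
    refine ⟨n, ?_, hlt, ?_⟩
    · simp at hpar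
      simp [ghStep, hpar, hn, hpd, hB0 d hd]
    · simp at hpar
      simp [hpar]
  | goA u d r hu _ ih =>
    intro n hn hpar hlt
    simp at hpar
    have hst : ghStep A B n (ghWalk A B n) = pos (Sum.inr d) := by
      simp [ghStep, hpar, hn, hA1 u d hu]
    refine ih (n + 1) hst ?_ ?_
    · simp; omega
    · intro m hm
      rcases Nat.lt_succ_iff_lt_or_eq.mp hm with h | rfl
      · exact hlt m h
      · rw [hst, hn]
        intro hc
        exact absurd (hpinj hc) (by simp)
  | goB d u r hd _ ih =>
    intro n hn hpar hlt
    simp at hpar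
    have hst : ghStep A B n (ghWalk A B n) = pos (Sum.inl (some u)) := by
      simp [ghStep, hpar, hn, hpd, hpu, hB1 d u hd]
    refine ih (n + 1) hst ?_ ?_
    · simp; omega
    · intro m hm
      rcases Nat.lt_succ_iff_lt_or_eq.mp hm with h | rfl
      · exact hlt m h
      · rw [hst, hn]
        intro hc
        exact absurd (hpinj hc) (by simp)

theorem protocol_of_partial {X Y U D : Type} [Fintype U] [Fintype D]
    (fA : X → Option U → Option D) (fB : Y → D → Option U)
    (hA : ∀ x u u' d, fA x u = some d → fA x u' = some d → u = u')
    (hB : ∀ y d d' u, fB y d = some u → fB y d' = some u → d = d')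
    (f : X → Y → Bool) (hf : ∀ x y, GRun (fA x) (fB y) (Sum.inl none) (f x y)) :
    ∃ P : GHProtocol X Y (Fintype.card D + Fintype.card U), P.Computes f := by
  classical
  choose gA gA1 gA2 gA3 using fun x => exists_matching (fA x) (hA x)
  choose gB gB1 gB2 gB3 using fun y => exists_matching (fB y) (hB y)
  have e : D ⊕ U ≃ Fin (Fintype.card D + Fintype.card U) :=
    Fintype.equivFinOfCardEq Fintype.card_sum
  let E : Option U ⊕ D ≃ Option (Fin (Fintype.card D + Fintype.card U)) :=
    (regroup U D).symm.trans e.optionCongr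
  refine ⟨⟨fun x v => E (gA x (E.symm v)), fun y v => e (gB y (e.symm v)), ?_, ?_⟩, ?_⟩
  · intro x v; simp [gA1 x (E.symm v)]
  · intro y v; simp [gB1 y (e.symm v)]
  · intro x y
    obtain ⟨N, hN, hlt, hpar⟩ := run_halts e (fA x) (fB y) (fun v => E (gA x (E.symm v)))
      (fun v => e (gB y (e.symm v))) E E.injective (fun d => rfl) (fun u => rfl)
      (fun u hu => by simp [gA2 x u hu]) (fun u d hu => by simp [gA3 x u d hu])
      (fun d hd => by simp [gB2 y d hd]) (fun d u hd => by simp [gB3 y d u hd])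
      _ _ (hf x y) 0 rfl (by simp) (by simp)
    refine ⟨⟨N, hN⟩, ?_⟩
    have : ghLen (fun v => E (gA x (E.symm v))) (fun v => e (gB y (e.symm v))) = N := by
      apply le_antisymm
      · exact Nat.sInf_le hN
      · by_contra hc
        push Not at hc
        exact hlt _ hc (Nat.sInf_mem (s := {n | ghStep (fun v => E (gA x (E.symm v)))
          (fun v => e (gB y (e.symm v))) n (ghWalk (fun v => E (gA x (E.symm v)))
          (fun v => e (gB y (e.symm v))) n) = _}) ⟨N, hN⟩)
    simp only [this]
    exact hpar

/-! ## Permutation programs -/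

/-- A layer of a program: apply `perm` if both bits are set, then possibly halt. -/
structure Instr (X Y W : Type) where
  a : X → Bool
  b : Y → Bool
  perm : Equiv.Perm W
  fil : W → Option Bool

/-- Action of a layer on the state. -/
def Instr.act {X Y W : Type} (i : Instr X Y W) (x : X) (y : Y) (s : W) : W :=
  if i.a x && i.b y then i.perm s else s

/-- Evaluation of a program: either the final state or the verdict. -/
def evalP {X Y W : Type} (x : X) (y : Y) : List (Instr X Y W) → W → W ⊕ Bool
  | [], s => Sum.inl s
  | i :: l, s =>
    match i.fil (i.act x y s) with
    | some r => Sum.inr r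
    | none => evalP x y l (i.act x y s)

theorem evalP_append {X Y W : Type} (x : X) (y : Y) (l₁ l₂ : List (Instr X Y W)) (s : W) :
    evalP x y (l₁ ++ l₂) s = Sum.elim (evalP x y l₂) Sum.inr (evalP x y l₁ s) := by
  induction l₁ generalizing s with
  | nil => rfl
  | cons i l ih =>
    simp only [List.cons_append, evalP]
    rcases i.fil (i.act x y s) with _ | r
    · simp [ih]
    · simp

/-- Alice's partial map. -/
def progA {X Y W : Type} (l : List (Instr X Y W)) (s0 : W) (x : X) :
    Option (Fin l.length × Bool × W) →
      Option ((Fin l.length × Bool × W) ⊕ (Fin l.length × W))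
  | none => if h : 0 < l.length then some (Sum.inl (⟨0, h⟩, false, s0)) else none
  | some (t, false, s) => some (Sum.inl (t, true, if l[t].a x then l[t].perm s else s))
  | some (t, true, s) =>
    match l[t].fil s with
    | some true => some (Sum.inr (t, s))
    | some false => none
    | none => if h : t.1 + 1 < l.length then some (Sum.inl (⟨t.1 + 1, h⟩, false, s)) else none

/-- Bob's partial map. -/
def progB {X Y W : Type} (l : List (Instr X Y W)) (y : Y) :
    (Fin l.length × Bool × W) ⊕ (Fin l.length × W) → Option (Fin l.length × Bool × W)
  | Sum.inl (t, c, s) => some (t, xor c (!(l[t].b y)), s)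
  | Sum.inr _ => none

theorem progA_inj {X Y W : Type} (l : List (Instr X Y W)) (s0 : W) (x : X)
    (u u' d) (h : progA l s0 x u = some d) (h' : progA l s0 x u' = some d) : u = u' := by
  have key : ∀ u d, progA l s0 x u = some d →
      (u = none ∧ ∃ h, d = Sum.inl (⟨0, h⟩, false, s0)) ∨
      (∃ t s, u = some (t, false, s) ∧
        d = Sum.inl (t, true, if l[t].a x then l[t].perm s else s)) ∨
      (∃ t s, u = some (t, true, s) ∧ d = Sum.inr (t, s) ∧ l[t].fil s = some true) ∨
      (∃ t s, u = some (t, true, s) ∧ l[t].fil s = none ∧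
        ∃ h, d = Sum.inl (⟨t.1 + 1, h⟩, false, s)) := by
    rintro (_ | ⟨t, c, s⟩) d h
    · left
      simp only [progA] at h
      split_ifs at h with h0
      · exact ⟨rfl, h0, by simpa using h.symm⟩
    · right
      cases c
      · left
        exact ⟨t, s, rfl, by simpa [progA] using h.symm⟩
      · right
        simp only [progA] at h
        split at h
        · left
          exact ⟨t, s, rfl, by simpa using h.symm, by assumption⟩
        · simp at h
        · right
          split_ifs at h with h0
          exact ⟨t, s, rfl, by assumption, h0, by simpa using h.symm⟩
  rcases key u d h with ⟨rfl, h1, rfl⟩ | ⟨t, s, rfl, rfl⟩ | ⟨t, s, rfl, rfl, -⟩ |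
    ⟨t, s, rfl, -, h1, rfl⟩ <;>
  rcases key u' _ h' with ⟨rfl, h1', e⟩ | ⟨t', s', rfl, e⟩ | ⟨t', s', rfl, e, -⟩ |
    ⟨t', s', rfl, -, h1', e⟩ <;> simp at e <;> try rfl
  · obtain ⟨rfl, e⟩ := e
    split_ifs at e
    · simp at e; rw [e]
    · rw [e]
  · obtain ⟨rfl, rfl⟩ := e; rfl
  · obtain ⟨e, rfl⟩ := e
    rw [Fin.ext e]

theorem progB_inj {X Y W : Type} (l : List (Instr X Y W)) (y : Y)
    (d d' u) (h : progB l y d = some u) (h' : progB l y d' = some u) : d = d' := by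
  rcases d with ⟨t, c, s⟩ | _ <;> rcases d' with ⟨t', c', s'⟩ | _ <;> simp [progB] at h h'
  subst h
  simp at h'
  obtain ⟨rfl, h, rfl⟩ := h'
  generalize l[t'.1].b y = z at h
  cases c <;> cases c' <;> cases z <;> simp_all

/-- Verdict of a program (falling off the end means rejecting). -/
def verdict {W : Type} : W ⊕ Bool → Bool
  | Sum.inl _ => false
  | Sum.inr r => r

theorem prog_step {X Y W : Type} (l : List (Instr X Y W)) (s0 : W) (x : X) (y : Y)
    (t : ℕ) (ht : t < l.length) (s : W)
    (hnext : ∀ (h : t + 1 < l.length) (s' : W),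
      GRun (progA l s0 x) (progB l y) (Sum.inr (Sum.inl (⟨t + 1, h⟩, false, s')))
        (verdict (evalP x y (l.drop (t + 1)) s'))) :
    GRun (progA l s0 x) (progB l y) (Sum.inr (Sum.inl (⟨t, ht⟩, false, s)))
      (verdict (evalP x y (l.drop t) s)) := by
  rw [List.drop_eq_getElem_cons ht]
  have main : GRun (progA l s0 x) (progB l y)
      (Sum.inl (some (⟨t, ht⟩, true, l[t].act x y s)))
      (verdict (evalP x y (l[t] :: l.drop (t + 1)) s)) := by
    rcases hfil : l[t].fil (l[t].act x y s) with _ | _ | _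
    · have hev : evalP x y (l[t] :: l.drop (t + 1)) s =
          evalP x y (l.drop (t + 1)) (l[t].act x y s) := by simp [evalP, hfil]
      rw [hev]
      by_cases h : t + 1 < l.length
      · exact GRun.goA _ _ _ (by simp [progA, hfil, h]) (hnext h _)
      · rw [List.drop_eq_nil_of_le (by omega)]
        exact GRun.stopA _ (by simp [progA, hfil, h])
    · have hev : evalP x y (l[t] :: l.drop (t + 1)) s = Sum.inr false := by simp [evalP, hfil]
      rw [hev]
      exact GRun.stopA _ (by simp [progA, hfil])
    · have hev : evalP x y (l[t] :: l.drop (t + 1)) s = Sum.inr true := by simp [evalP, hfil]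
      rw [hev]
      exact GRun.goA _ (Sum.inr (⟨t, ht⟩, l[t].act x y s)) _ (by simp [progA, hfil])
        (GRun.stopB _ rfl)
  rcases hb : l[t].b y with _ | _
  · refine GRun.goB _ (⟨t, ht⟩, true, s) _ (by simp [progB, hb]) ?_
    have : l[t].act x y s = s := by simp [Instr.act, hb]
    rw [this] at main
    exact main
  · refine GRun.goB _ (⟨t, ht⟩, false, s) _ (by simp [progB, hb]) ?_
    refine GRun.goA _ (Sum.inl (⟨t, ht⟩, true, l[t].act x y s)) _
      (by simp [progA, Instr.act, hb]) ?_
    exact GRun.goB _ (⟨t, ht⟩, true, l[t].act x y s) _ (by simp [progB, hb]) main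

theorem prog_run {X Y W : Type} (l : List (Instr X Y W)) (s0 : W) (x : X) (y : Y)
    (k : ℕ) : ∀ (t : ℕ) (ht : t < l.length) (s : W), l.length ≤ t + 1 + k →
    GRun (progA l s0 x) (progB l y) (Sum.inr (Sum.inl (⟨t, ht⟩, false, s)))
      (verdict (evalP x y (l.drop t) s)) := by
  induction k with
  | zero =>
    intro t ht s hk
    exact prog_step l s0 x y t ht s (fun h => by omega)
  | succ k ih =>
    intro t ht s hk
    exact prog_step l s0 x y t ht s (fun h s' => ih (t + 1) h s' (by omega))

theorem protocol_of_program {X Y W : Type} [Fintype W] (l : List (Instr X Y W)) (s0 : W) :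
    ∃ P : GHProtocol X Y (5 * l.length * Fintype.card W),
      P.Computes (fun x y => verdict (evalP x y l s0)) := by
  have h := protocol_of_partial (progA l s0) (progB l) (progA_inj l s0) (progB_inj l)
    (fun x y => verdict (evalP x y l s0)) (by
      intro x y
      by_cases h : 0 < l.length
      · refine GRun.goA _ (Sum.inl (⟨0, h⟩, false, s0)) _ (by simp [progA, h]) ?_
        have := prog_run l s0 x y (l.length - 1) 0 h s0 (by omega)
        simpa using this
      · have : l = [] := by simpa using h
        subst this
        exact GRun.stopA _ (by simp [progA]))
  have hc : Fintype.card ((Fin l.length × Bool × W) ⊕ (Fin l.length × W)) +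
      Fintype.card (Fin l.length × Bool × W) = 5 * l.length * Fintype.card W := by
    simp; ring
  rw [hc] at h
  exact h

/-! ## Reversal of filter-free programs -/

/-- State after running a filter-free program. -/
def actL {X Y W : Type} (x : X) (y : Y) (l : List (Instr X Y W)) (s : W) : W :=
  l.foldl (fun s i => i.act x y s) s

theorem actL_append {X Y W : Type} (x : X) (y : Y) (l₁ l₂ : List (Instr X Y W)) (s : W) :
    actL x y (l₁ ++ l₂) s = actL x y l₂ (actL x y l₁ s) := by
  simp [actL]

theorem evalP_pure {X Y W : Type} (x : X) (y : Y) (l : List (Instr X Y W))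
    (hl : ∀ i ∈ l, ∀ s, i.fil s = none) (s : W) :
    evalP x y l s = Sum.inl (actL x y l s) := by
  induction l generalizing s with
  | nil => rfl
  | cons i l ih =>
    have h1 := hl i (by simp)
    have h2 := ih (fun j hj => hl j (by simp [hj]))
    simp [evalP, h1, h2, actL]

/-- Inverse layer. -/
def Instr.inv {X Y W : Type} (i : Instr X Y W) : Instr X Y W :=
  ⟨i.a, i.b, i.perm⁻¹, i.fil⟩

/-- Reversed program. -/
def invL {X Y W : Type} (l : List (Instr X Y W)) : List (Instr X Y W) :=
  (l.map Instr.inv).reverse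

theorem actL_invL {X Y W : Type} (x : X) (y : Y) (l : List (Instr X Y W)) (s : W) :
    actL x y (invL l) (actL x y l s) = s := by
  induction l generalizing s with
  | nil => rfl
  | cons i l ih =>
    have h1 : invL (i :: l) = invL l ++ [i.inv] := by simp [invL]
    have h2 : actL x y (i :: l) s = actL x y l (i.act x y s) := rfl
    rw [h1, h2, actL_append, ih]
    simp only [actL, List.foldl, Instr.act, Instr.inv]
    split_ifs <;> simp

theorem invL_pure {X Y W : Type} (l : List (Instr X Y W))
    (hl : ∀ i ∈ l, ∀ s, i.fil s = none) : ∀ i ∈ invL l, ∀ s, i.fil s = none := by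
  intro i hi s
  simp only [invL, List.mem_reverse, List.mem_map] at hi
  obtain ⟨j, hj, rfl⟩ := hi
  exact hl j hj s

/-! ## Modular counters -/

/-- Addition of `a` modulo `q` on the first `q` states. -/
def shiftF (w q : ℕ) (a : ℤ) (s : Fin w) : Fin w :=
  if h : s.1 < q ∧ q ≤ w then
    ⟨((s.1 + a) % q).toNat, by
      have h1 : (0 : ℤ) < q := by omega
      have h2 := Int.emod_lt_of_pos (s.1 + a) h1
      have h3 := Int.emod_nonneg (s.1 + a) h1.ne'
      omega⟩
  else s

theorem shiftF_val (w q : ℕ) (a : ℤ) (s : Fin w) (h1 : s.1 < q) (h2 : q ≤ w) :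
    ((shiftF w q a s).1 : ℤ) = (s.1 + a) % q := by
  have h3 := Int.emod_nonneg (s.1 + a) (show (q : ℤ) ≠ 0 by omega)
  simp [shiftF, h1, h2, h3]

theorem shiftF_lt (w q : ℕ) (a : ℤ) (s : Fin w) (h1 : s.1 < q) (h2 : q ≤ w) :
    (shiftF w q a s).1 < q := by
  have h3 := shiftF_val w q a s h1 h2
  have h4 := Int.emod_lt_of_pos (s.1 + a) (show (0 : ℤ) < q by omega)
  omega

theorem shiftF_inj (w q : ℕ) (a : ℤ) : Function.Injective (shiftF w q a) := by
  intro s s' h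
  by_cases h2 : q ≤ w
  · by_cases h1 : s.1 < q <;> by_cases h1' : s'.1 < q
    · have e1 := shiftF_val w q a s h1 h2
      have e2 := shiftF_val w q a s' h1' h2
      rw [h, e2] at e1
      have e3 : (s'.1 : ℤ) ≡ s.1 [ZMOD q] := Int.ModEq.add_right_cancel' a e1
      have e4 : (s'.1 : ℤ) = s.1 := by
        have := Int.emod_eq_of_lt (show (0 : ℤ) ≤ s.1 by omega) (show (s.1 : ℤ) < q by omega)
        have := Int.emod_eq_of_lt (show (0 : ℤ) ≤ s'.1 by omega) (show (s'.1 : ℤ) < q by omega)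
        unfold Int.ModEq at e3
        omega
      exact Fin.ext (by omega)
    · have := shiftF_lt w q a s h1 h2
      rw [h] at this
      simp [shiftF, h1'] at this
    · have := shiftF_lt w q a s' h1' h2
      rw [← h] at this
      simp [shiftF, h1] at this
    · simpa [shiftF, h1, h1'] using h
  · simpa [shiftF, h2] using h

/-- The shift as a permutation. -/
noncomputable def shiftP (w q : ℕ) (a : ℤ) : Equiv.Perm (Fin w) :=
  Equiv.ofBijective _ (Finite.injective_iff_bijective.mp (shiftF_inj w q a))

abbrev BInstr (n w : ℕ) := Instr (Fin n → Bool) (Fin n → Bool) (Fin w)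

/-- Layer adding `2a` modulo `q` if `x i ∧ y i`. -/
noncomputable def bitGate {n w : ℕ} (q : ℕ) (a : ℤ) (i : Fin n) : BInstr n w :=
  ⟨fun x => x i, fun y => y i, shiftP w q (2 * a), fun _ => none⟩

/-- Layer adding `- a n` modulo `q`. -/
noncomputable def constGate {n w : ℕ} (q : ℕ) (a : ℤ) : BInstr n w :=
  ⟨fun _ => true, fun _ => true, shiftP w q (-(a * n)), fun _ => none⟩

/-- Layers adding `a (2 Σ xᵢ yᵢ - n)` modulo `q`. -/
noncomputable def gatesQ (n w : ℕ) (q : ℕ) (a : ℤ) : List (BInstr n w) :=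
  (List.finRange n).map (bitGate q a) ++ [constGate q a]

theorem bitGates_act {n w : ℕ} (q : ℕ) (a : ℤ) (hq : q ≤ w) (x y : Fin n → Bool)
    (L : List (Fin n)) (s : Fin w) (hs : s.1 < q) :
    (actL x y (L.map (bitGate q a)) s).1 < q ∧
    (((actL x y (L.map (bitGate q a)) s).1 : ℤ) ≡
      s.1 + a * (2 * (L.countP (fun i => x i && y i) : ℕ)) [ZMOD q]) := by
  induction L generalizing s with
  | nil => simp [actL, hs]
  | cons i L ih =>
    have h0 : actL x y ((i :: L).map (bitGate q a)) s =
      actL x y (L.map (bitGate q a)) ((bitGate q a i).act x y s) := rfl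
    rw [h0]
    by_cases h : x i && y i
    · have h1 : (bitGate q a i).act x y s = shiftF w q (2 * a) s := by
        simp only [Instr.act, bitGate, h]; rfl
      rw [h1]
      obtain ⟨h2, h3⟩ := ih _ (shiftF_lt w q (2 * a) s hs hq)
      refine ⟨h2, h3.trans ?_⟩
      rw [shiftF_val w q _ s hs hq, List.countP_cons_of_pos (by simpa using h)]
      have : ((s.1 + 2 * a) % q : ℤ) ≡ s.1 + 2 * a [ZMOD q] := Int.mod_modEq _ _
      refine (this.add_right _).trans ?_
      push_cast
      ring_nf
      rfl
    · have h1 : (bitGate q a i).act x y s = s := by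
        exact if_neg h
      rw [h1, List.countP_cons_of_neg (by simpa using h)]
      exact ih s hs

/-- The signed quantity `2 Σ xᵢ yᵢ - n`. -/
def dval {n : ℕ} (x y : Fin n → Bool) : ℤ :=
  2 * ((Finset.univ.filter fun i => x i = true ∧ y i = true).card : ℕ) - n

theorem countP_finRange {n : ℕ} (x y : Fin n → Bool) :
    (List.finRange n).countP (fun i => x i && y i) =
      (Finset.univ.filter fun i => x i = true ∧ y i = true).card := by
  rw [List.countP_eq_length_filter]
  rw [← List.toFinset_card_of_nodup ((List.nodup_finRange n).filter _)]
  congr 1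
  ext i
  simp

theorem gatesQ_act {n w : ℕ} (q : ℕ) (a : ℤ) (hq : q ≤ w) (x y : Fin n → Bool)
    (s : Fin w) (hs : s.1 < q) :
    (actL x y (gatesQ n w q a) s).1 < q ∧
    (((actL x y (gatesQ n w q a) s).1 : ℤ) ≡ s.1 + a * dval x y [ZMOD q]) := by
  obtain ⟨h1, h2⟩ := bitGates_act q a hq x y (List.finRange n) s hs
  rw [gatesQ, actL_append]
  generalize actL x y ((List.finRange n).map (bitGate q a)) s = s' at h1 h2
  have h0 : actL x y [constGate q a] s' = shiftF w q (-(a * n)) s' := rfl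
  rw [h0]
  refine ⟨shiftF_lt w q _ s' h1 hq, ?_⟩
  rw [shiftF_val w q _ s' h1 hq]
  refine (Int.mod_modEq _ _).trans ?_
  refine (h2.add_right _).trans ?_
  rw [countP_finRange, dval]
  ring_nf
  rfl

/-- All counters of one stage. -/
noncomputable def gatesAll (n w m : ℕ) (a : ℕ → ℤ) (K : ℕ) : List (BInstr n w) :=
  (List.range K).flatMap (fun i => gatesQ n w (m + i) (a i))

theorem gatesAll_succ (n w m : ℕ) (a : ℕ → ℤ) (K : ℕ) :
    gatesAll n w m a (K + 1) = gatesAll n w m a K ++ gatesQ n w (m + K) (a K) := by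
  simp [gatesAll, List.range_succ]

theorem gatesAll_length (n w m : ℕ) (a : ℕ → ℤ) (K : ℕ) :
    (gatesAll n w m a K).length = K * (n + 1) := by
  induction K with
  | zero => simp [gatesAll]
  | succ K ih => rw [gatesAll_succ, List.length_append, ih]; simp [gatesQ]; ring

theorem gatesAll_pure (n w m : ℕ) (a : ℕ → ℤ) (K : ℕ) :
    ∀ i ∈ gatesAll n w m a K, ∀ s, i.fil s = none := by
  intro i hi s
  simp only [gatesAll, gatesQ, List.mem_flatMap, List.mem_append, List.mem_map,
    List.mem_singleton] at hi
  obtain ⟨j, -, ⟨k, -, rfl⟩ | rfl⟩ := hi <;> rfl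

theorem gatesAll_act {n w : ℕ} (m : ℕ) (hm : 0 < m) (a : ℕ → ℤ) (x y : Fin n → Bool)
    (s : Fin w) (hs : s.1 = 0) (K : ℕ) (hK : m + K ≤ w) :
    (actL x y (gatesAll n w m a K) s).1 < m + K ∧
    ∃ (z : ℤ) (err : ℚ), 0 ≤ err ∧ err ≤ K / m ∧
      ((actL x y (gatesAll n w m a K) s).1 : ℚ) / (m + K) =
        dval x y * (∑ i ∈ Finset.range K, (a i : ℚ) / (m + i)) - err - z := by
  induction K with
  | zero =>
    refine ⟨by simp [gatesAll, actL, hs, hm], 0, 0, le_rfl, by simp, by simp [gatesAll, actL, hs]⟩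
  | succ K ih =>
    obtain ⟨h1, z, err, he0, he1, he⟩ := ih (by omega)
    rw [gatesAll_succ, actL_append]
    generalize actL x y (gatesAll n w m a K) s = s' at h1 he
    obtain ⟨h2, h3⟩ := gatesQ_act (m + K) (a K) (by omega) x y s' h1
    generalize actL x y (gatesQ n w (m + K) (a K)) s' = t at h2 h3
    refine ⟨by omega, ?_⟩
    obtain ⟨c, hc⟩ := h3.dvd
    have hcQ : (s'.1 : ℚ) + a K * dval x y - t.1 = (m + K) * c := by exact_mod_cast hc
    have hmQ : (0 : ℚ) < m := by exact_mod_cast hm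
    have hKQ : (0 : ℚ) ≤ K := by positivity
    have htQ : (t.1 : ℚ) ≤ m + K := by exact_mod_cast h2.le
    have ht0 : (0 : ℚ) ≤ t.1 := by positivity
    refine ⟨z + c, err + t.1 / ((m + K) * (m + K + 1)), by positivity, ?_, ?_⟩
    · have : (t.1 : ℚ) / ((m + K) * (m + K + 1)) ≤ 1 / m := by
        rw [div_le_div_iff₀ (by positivity) hmQ]
        nlinarith
      push_cast
      rw [add_div]
      linarith
    · rw [Finset.sum_range_succ]
      have e1 : (t.1 : ℚ) / (m + K) = s'.1 / (m + K) + a K * dval x y / (m + K) - c := by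
        field_simp
        linarith
      have e2 : (t.1 : ℚ) / (m + (K + 1 : ℕ)) =
          t.1 / (m + K) - t.1 / ((m + K) * (m + K + 1)) := by
        push_cast
        field_simp
        ring
      rw [e2, e1, he]
      push_cast
      ring

/-! ## The partial fraction identity -/

theorem alt_sum_succ (f : ℕ → ℚ) (k : ℕ) :
    ∑ i ∈ Finset.range (k + 2), (-1 : ℚ) ^ i * (k + 1).choose i * f i =
      ∑ i ∈ Finset.range (k + 1), (-1 : ℚ) ^ i * k.choose i * f i -
      ∑ i ∈ Finset.range (k + 1), (-1 : ℚ) ^ i * k.choose i * f (i + 1) := by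
  have h1 : ∑ i ∈ Finset.range (k + 1), (-1 : ℚ) ^ i * k.choose i * f i =
      ∑ i ∈ Finset.range (k + 2), (-1 : ℚ) ^ i * k.choose i * f i := by
    rw [Finset.sum_range_succ _ (k + 1)]
    simp
  rw [h1, Finset.sum_range_succ', Finset.sum_range_succ' _ (k + 1)]
  have h2 : ∀ i ∈ Finset.range (k + 1),
      (-1 : ℚ) ^ (i + 1) * ((k + 1).choose (i + 1) : ℕ) * f (i + 1) =
      (-1 : ℚ) ^ (i + 1) * (k.choose (i + 1) : ℕ) * f (i + 1) -
        (-1 : ℚ) ^ i * (k.choose i : ℕ) * f (i + 1) := by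
    intro i _
    rw [Nat.choose_succ_succ]
    push_cast
    ring
  rw [Finset.sum_congr rfl h2, Finset.sum_sub_distrib]
  simp
  ring

theorem partial_fraction (k : ℕ) : ∀ m : ℕ, 0 < m →
    ∑ i ∈ Finset.range (k + 1), (-1 : ℚ) ^ i * k.choose i * (1 / ((m : ℚ) + i)) =
      1 / (m * (m + k).choose k) := by
  induction k with
  | zero => intro m hm; simp
  | succ k ih =>
    intro m hm
    rw [alt_sum_succ (fun i => 1 / ((m : ℚ) + i)), ih m hm]
    have h := ih (m + 1) (by omega)
    have h' : ∑ i ∈ Finset.range (k + 1), (-1 : ℚ) ^ i * k.choose i *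
        (1 / ((m : ℚ) + (i + 1 : ℕ))) = 1 / ((m + 1 : ℕ) * (m + 1 + k).choose k) := by
      rw [← h]
      apply Finset.sum_congr rfl
      intro i _
      push_cast
      ring
    rw [h']
    have hmQ : (0 : ℚ) < m := by exact_mod_cast hm
    have c1 : ((m + 1 + k).choose k : ℚ) * (m + 1) = (m + k).choose k * (m + k + 1) := by
      have := Nat.add_one_mul_choose_eq (m + k) m
      have e1 : (m + k + 1).choose (m + 1) = (m + 1 + k).choose k := by
        rw [show m + k + 1 = (m + 1) + k by ring]; exact Nat.choose_symm_add
      have e2 : (m + k).choose m = (m + k).choose k := Nat.choose_symm_add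
      rw [e1, e2] at this
      have : (((m + k + 1) * (m + k).choose k : ℕ) : ℚ) = ((m + 1 + k).choose k * (m + 1) : ℕ) := by
        exact_mod_cast this
      push_cast at this
      linarith
    have c2 : ((m + (k + 1)).choose (k + 1) : ℚ) * (k + 1) = (m + k).choose k * (m + k + 1) := by
      have := Nat.add_one_mul_choose_eq (m + k) k
      have : (((m + k + 1) * (m + k).choose k : ℕ) : ℚ) =
        ((m + (k + 1)).choose (k + 1) * (k + 1) : ℕ) := by
        exact_mod_cast this
      push_cast at this
      linarith
    have p0 : (0 : ℚ) < (m + k).choose k := by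
      exact_mod_cast Nat.choose_pos (by omega)
    have d1 : ((m + 1 + k).choose k : ℚ) = (m + k).choose k * (m + k + 1) / (m + 1) := by
      rw [← c1]; field_simp
    have d2 : ((m + (k + 1)).choose (k + 1) : ℚ) = (m + k).choose k * (m + k + 1) / (k + 1) := by
      rw [← c2]; field_simp
    rw [d1, d2]
    push_cast
    field_simp
    ring

/-! ## One stage of the comparison -/

/-- Verdict filter at the end of the forward part of a stage. -/
def stageFil (w : ℕ) (s : Fin w) : Option Bool :=
  if 2 * s.1 ≤ w then some true else if 8 * s.1 < 7 * w then some false else none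

/-- Coefficients of stage `j`. -/
def coef (k j : ℕ) (i : ℕ) : ℤ := (-1) ^ i * k.choose i * 2 ^ j

/-- A stage: compute, filter, uncompute. -/
noncomputable def stage (n m k j : ℕ) : List (BInstr n (m + (k + 1))) :=
  gatesAll n (m + (k + 1)) m (coef k j) (k + 1) ++
    ([⟨fun _ => false, fun _ => false, 1, stageFil _⟩] ++
      invL (gatesAll n (m + (k + 1)) m (coef k j) (k + 1)))

theorem stage_length (n m k j : ℕ) :
    (stage n m k j).length = 2 * ((k + 1) * (n + 1)) + 1 := by
  simp [stage, invL, gatesAll_length]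
  ring

theorem coef_sum (m k j : ℕ) (hm : 0 < m) :
    ∑ i ∈ Finset.range (k + 1), (coef k j i : ℚ) / ((m : ℚ) + i) =
      2 ^ j / ((m * (m + k).choose k : ℕ) : ℚ) := by
  have h := partial_fraction k m hm
  rw [show (2 : ℚ) ^ j / ((m * (m + k).choose k : ℕ) : ℚ) =
    2 ^ j * (1 / ((m : ℚ) * (m + k).choose k)) by push_cast; ring, ← h, Finset.mul_sum]
  apply Finset.sum_congr rfl
  intro i _
  simp only [coef]
  push_cast
  ring

theorem stage_eval {n : ℕ} (m k j : ℕ) (hm : m = 8 * (k + 1)) (x y : Fin n → Bool)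
    (s : Fin (m + (k + 1))) (hs : s.1 = 0)
    (hb : 4 * |dval x y| * 2 ^ j ≤ ((m * (m + k).choose k : ℕ) : ℤ)) :
    evalP x y (stage n m k j) s = Sum.inr (decide (0 ≤ dval x y)) ∨
    (evalP x y (stage n m k j) s = Sum.inl s ∧
      4 * |dval x y| * 2 ^ (j + 1) ≤ ((m * (m + k).choose k : ℕ) : ℤ)) := by
  have hm0 : 0 < m := by omega
  obtain ⟨h1, z, err, he0, he1, he⟩ :=
    gatesAll_act m hm0 (coef k j) x y s hs (k + 1) le_rfl
  have hinv := actL_invL x y (gatesAll n (m + (k + 1)) m (coef k j) (k + 1)) s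
  have hev : evalP x y (stage n m k j) s =
      match stageFil _ (actL x y (gatesAll n (m + (k + 1)) m (coef k j) (k + 1)) s) with
      | some r => Sum.inr r
      | none => Sum.inl s := by
    rw [stage, evalP_append, evalP_pure _ _ _ (gatesAll_pure _ _ _ _ _)]
    simp only [Sum.elim_inl, List.singleton_append, evalP, Instr.act, Bool.and_self,
      Bool.false_eq_true, if_false]
    rw [evalP_pure _ _ _ (invL_pure _ (gatesAll_pure _ _ _ _ _)), hinv]
  rw [coef_sum m k j hm0] at he
  rw [hev]
  clear hev hinv
  generalize actL x y (gatesAll n (m + (k + 1)) m (coef k j) (k + 1)) s = t at h1 he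
  generalize dval x y = Y at *
  have hDpos : 0 < m * (m + k).choose k := Nat.mul_pos hm0 (Nat.choose_pos (by omega))
  generalize m * (m + k).choose k = D at *
  have hD : (0 : ℚ) < D := by exact_mod_cast hDpos
  have hbQ : 4 * |(Y : ℚ)| * 2 ^ j ≤ D := by exact_mod_cast hb
  obtain ⟨θ, hθ⟩ : ∃ θ : ℚ, θ = Y * (2 ^ j / D) := ⟨_, rfl⟩
  rw [← hθ] at he
  have hθD : θ * D = Y * 2 ^ j := by rw [hθ]; field_simp
  have habs : |θ| * D = |(Y : ℚ)| * 2 ^ j := by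
    have h2 : |(2 : ℚ) ^ j| = 2 ^ j := abs_of_pos (by positivity)
    have h3 : |(D : ℚ)| = D := abs_of_pos hD
    have h4 := congrArg abs hθD
    rwa [abs_mul, abs_mul, h2, h3] at h4
  have hθ4 : |θ| ≤ 1 / 4 := by
    by_contra hc
    push Not at hc
    nlinarith
  have herr : err ≤ 1 / 8 := by
    refine he1.trans (le_of_eq ?_)
    rw [hm]; push_cast; field_simp
  obtain ⟨hl, hr⟩ := abs_le.mp hθ4
  have hwQ : (0 : ℚ) < m + (k + 1 : ℕ) := by positivity
  have hsgn : 0 ≤ θ ↔ 0 ≤ Y := by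
    rw [hθ]
    rw [mul_nonneg_iff_of_pos_right (by positivity)]
    exact_mod_cast Iff.rfl
  -- the fractional value
  obtain ⟨v, hv⟩ : ∃ v : ℚ, v = (t.1 : ℚ) / (m + (k + 1 : ℕ)) := ⟨_, rfl⟩
  rw [← hv] at he
  have hvt : (t.1 : ℚ) = v * (m + (k + 1 : ℕ)) := by rw [hv]; field_simp
  have hv0 : 0 ≤ v := by rw [hv]; positivity
  have hv1 : v < 1 := by
    rw [hv, div_lt_one hwQ]; exact_mod_cast h1
  have hz1 : (-2 : ℚ) < z := by linarith
  have hz2 : (z : ℚ) < 1 := by linarith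
  have hz1' : -2 < z := by exact_mod_cast hz1
  have hz2' : z < 1 := by exact_mod_cast hz2
  have hz : z = 0 ∨ z = -1 := by omega
  unfold stageFil
  rcases hz with rfl | rfl
  · -- nonnegative
    left
    have hle : 2 * t.1 ≤ m + (k + 1) := by
      have : (2 : ℚ) * t.1 ≤ m + (k + 1 : ℕ) := by
        push_cast at he
        rw [hvt]; nlinarith
      exact_mod_cast this
    have hY : 0 ≤ Y := by
      rw [← hsgn]; push_cast at he; linarith
    simp [hle, hY]
  · have hnle : ¬ 2 * t.1 ≤ m + (k + 1) := by
      intro hc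
      have hc : (2 : ℚ) * t.1 ≤ m + (k + 1 : ℕ) := by exact_mod_cast hc
      push_cast at he
      rw [hvt] at hc
      nlinarith
    by_cases h8 : 8 * t.1 < 7 * (m + (k + 1))
    · left
      have hc : (8 : ℚ) * t.1 < 7 * (m + (k + 1 : ℕ)) := by exact_mod_cast h8
      have hv78 : v < 7 / 8 := by
        rw [hvt] at hc
        nlinarith
      have hY : ¬ 0 ≤ Y := by
        rw [← hsgn]; push_cast at he; intro h; linarith
      simp [hnle, h8, hY]
    · right
      have hc : (7 : ℚ) * (m + (k + 1 : ℕ)) ≤ 8 * t.1 := by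
        push Not at h8; exact_mod_cast h8
      have hv78 : 7 / 8 ≤ v := by
        rw [hvt] at hc
        nlinarith
      have h18 : |θ| ≤ 1 / 8 := by
        push_cast at he
        rw [abs_le]; constructor <;> linarith
      refine ⟨by simp [hnle, h8], ?_⟩
      have : 4 * |(Y : ℚ)| * 2 ^ (j + 1) ≤ D := by
        rw [pow_succ]
        nlinarith
      exact_mod_cast this

/-! ## The full program -/

/-- The stages `0, …, J - 1`. -/
noncomputable def stages (n m k J : ℕ) : List (BInstr n (m + (k + 1))) :=
  (List.range J).flatMap (stage n m k)

theorem stages_succ (n m k J : ℕ) : stages n m k (J + 1) = stages n m k J ++ stage n m k J := by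
  simp [stages, List.range_succ]

theorem stages_length (n m k J : ℕ) :
    (stages n m k J).length = J * (2 * ((k + 1) * (n + 1)) + 1) := by
  induction J with
  | zero => simp [stages]
  | succ J ih => rw [stages_succ, List.length_append, ih, stage_length]; ring

theorem stages_eval {n : ℕ} (m k : ℕ) (hm : m = 8 * (k + 1)) (x y : Fin n → Bool)
    (s : Fin (m + (k + 1))) (hs : s.1 = 0)
    (hb : 4 * |dval x y| ≤ ((m * (m + k).choose k : ℕ) : ℤ)) (J : ℕ) :
    evalP x y (stages n m k J) s = Sum.inr (decide (0 ≤ dval x y)) ∨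
    (evalP x y (stages n m k J) s = Sum.inl s ∧
      4 * |dval x y| * 2 ^ J ≤ ((m * (m + k).choose k : ℕ) : ℤ)) := by
  induction J with
  | zero => right; exact ⟨rfl, by simpa using hb⟩
  | succ J ih =>
    rw [stages_succ, evalP_append]
    rcases ih with h | ⟨h, h'⟩
    · left; rw [h]; rfl
    · rw [h]
      exact stage_eval m k J hm x y s hs h'

/-- The complete program. -/
noncomputable def fullProg (n m k J : ℕ) : List (BInstr n (m + (k + 1))) :=
  stages n m k J ++ [⟨fun _ => false, fun _ => false, 1, fun _ => some true⟩]

theorem fullProg_verdict {n : ℕ} (m k J : ℕ) (hm : m = 8 * (k + 1)) (x y : Fin n → Bool)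
    (s : Fin (m + (k + 1))) (hs : s.1 = 0)
    (hb : 4 * n ≤ m * (m + k).choose k) (hJ : m * (m + k).choose k ≤ 2 ^ J) :
    verdict (evalP x y (fullProg n m k J) s) = DMAJ n x y := by
  have hcard : (Finset.univ.filter fun i => x i = true ∧ y i = true).card ≤ n := by
    simpa using Finset.card_le_univ (Finset.univ.filter fun i => x i = true ∧ y i = true)
  have habs : |dval x y| ≤ n := by
    rw [abs_le]; unfold dval; constructor <;> omega
  have hdec : DMAJ n x y = decide (0 ≤ dval x y) := by
    unfold DMAJ dval
    congr 1
    apply propext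
    constructor <;> intro h <;> omega
  have hb' : 4 * |dval x y| ≤ ((m * (m + k).choose k : ℕ) : ℤ) := by
    have : ((4 * n : ℕ) : ℤ) ≤ ((m * (m + k).choose k : ℕ) : ℤ) := by exact_mod_cast hb
    push_cast at this ⊢
    linarith
  rw [fullProg, evalP_append, hdec]
  rcases stages_eval m k hm x y s hs hb' J with h | ⟨h, h'⟩
  · rw [h]; rfl
  · rw [h]
    have hJ' : ((m * (m + k).choose k : ℕ) : ℤ) ≤ 2 ^ J := by exact_mod_cast hJ
    have h0 : dval x y = 0 := by
      by_contra hne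
      have : 1 ≤ |dval x y| := Int.one_le_abs hne
      have h2 : (0 : ℤ) < 2 ^ J := by positivity
      nlinarith
    simp [evalP, verdict, h0]

theorem size_lower (k : ℕ) (hk : 0 < k) : 4 ^ k ≤ (8 * (k + 1)) * (8 * (k + 1) + k).choose k := by
  have h1 := Nat.four_pow_le_two_mul_self_mul_centralBinom k hk
  have h2 : k.centralBinom ≤ (8 * (k + 1) + k).choose k := by
    rw [Nat.centralBinom]
    exact Nat.choose_le_choose k (by omega)
  refine h1.trans (Nat.mul_le_mul (by omega) h2)

theorem size_upper (k : ℕ) :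
    (8 * (k + 1)) * (8 * (k + 1) + k).choose k ≤ 2 ^ (17 * (k + 1)) := by
  have h1 : (8 * (k + 1) + k).choose k ≤ 2 ^ (8 * (k + 1) + k) := Nat.choose_le_two_pow _ _
  have h2 : 8 * (k + 1) ≤ 2 ^ (8 * (k + 1)) := Nat.lt_two_pow_self.le
  refine (Nat.mul_le_mul h2 h1).trans ?_
  rw [← pow_add]
  exact Nat.pow_le_pow_right (by norm_num) (by omega)

theorem size_n (n : ℕ) : 4 * n ≤ 4 ^ (Nat.log 2 n + 2) := by
  have h := Nat.lt_pow_succ_log_self (b := 2) (by norm_num) n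
  have h2 : (2 : ℕ) ^ (Nat.log 2 n).succ ≤ 4 ^ (Nat.log 2 n + 1) :=
    Nat.pow_le_pow_left (by norm_num) _
  rw [pow_succ 4 (Nat.log 2 n + 1)]
  omega

theorem size_total (n L : ℕ) (h : n = 0 → L = 0) :
    5 * (17 * (L + 3) * (2 * ((L + 3) * (n + 1)) + 1) + 1) * (9 * (L + 3)) ≤
      1000000 * (n * (L + 1) ^ 3 + 1) := by
  have hK : L + 3 ≤ 3 * (L + 1) := by omega
  have h1 : (n + 1) * (L + 1) ^ 3 ≤ 2 * (n * (L + 1) ^ 3 + 1) := by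
    rcases Nat.eq_zero_or_pos n with rfl | hn
    · simp [h rfl]
    · nlinarith [Nat.mul_le_mul_right ((L + 1) ^ 3) hn]
  have h3 : (L + 3) ^ 3 ≤ 27 * (L + 1) ^ 3 :=
    (Nat.pow_le_pow_left hK 3).trans (le_of_eq (by ring))
  have hp : 1 ≤ (L + 3) * (n + 1) := Nat.mul_pos (by omega) (by omega)
  calc 5 * (17 * (L + 3) * (2 * ((L + 3) * (n + 1)) + 1) + 1) * (9 * (L + 3))
      ≤ 5 * (17 * (L + 3) * (3 * ((L + 3) * (n + 1))) + (L + 3) * ((L + 3) * (n + 1))) *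
          (9 * (L + 3)) := by
        gcongr
        · omega
        · exact Nat.mul_pos (by omega) hp
    _ = 2340 * ((n + 1) * (L + 3) ^ 3) := by ring
    _ ≤ 2340 * ((n + 1) * (27 * (L + 1) ^ 3)) := by gcongr
    _ = 63180 * ((n + 1) * (L + 1) ^ 3) := by ring
    _ ≤ 63180 * (2 * (n * (L + 1) ^ 3 + 1)) := by gcongr
    _ ≤ 1000000 * (n * (L + 1) ^ 3 + 1) := by omega


/-- The Distributed Majority function has garden-hose complexity
`O(n · log³ n)`. -/
theorem GH_distributed_majority :
    ∃ C : ℕ, 0 < C ∧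
      ∀ n : ℕ, ∃ s ≤ C * (n * (Nat.log 2 n + 1) ^ 3 + 1),
        ∃ P : GHProtocol (Fin n → Bool) (Fin n → Bool) s, P.Computes (DMAJ n) := by
  refine ⟨1000000, by norm_num, fun n => ?_⟩
  obtain ⟨P, hP⟩ := protocol_of_program
    (fullProg n (8 * (Nat.log 2 n + 2 + 1)) (Nat.log 2 n + 2) (17 * (Nat.log 2 n + 2 + 1)))
    ⟨0, by omega⟩
  refine ⟨_, ?_, P, ?_⟩
  · have hlen := size_total n (Nat.log 2 n) (by rintro rfl; simp)
    refine le_trans (le_of_eq ?_) hlen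
    simp only [fullProg, List.length_append, stages_length, List.length_singleton,
      Fintype.card_fin]
    ring
  · intro x y
    have h := hP x y
    have hv := fullProg_verdict (n := n) _ _ _ rfl x y ⟨0, by omega⟩ rfl
      ((size_n n).trans (size_lower _ (by omega))) (size_upper (Nat.log 2 n + 2))
    simp only [hv] at h
    exact h
end

section
/- If f₁,…,f_k are Boolean functions with garden-hose complexities GH(f₁),…,GH(f_k), then GH(f₁ ∨ ⋯ ∨ f_k) = O(Σᵢ GH(fᵢ)), GH(f₁ ∧ ⋯ ∧ f_k) = O(Σᵢ GH(fᵢ)), and GH(f₁ ⊕ ⋯ ⊕ f_k) = O(Σᵢ GH(fᵢ)). -/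
/-- Paths of `n` (non-halting) steps; `M false` is the matching of Alice, `M true` that of Bob. -/
inductive GPath {V : Type} (M : Bool → V → V) : ℕ → Bool → V → Bool → V → Prop
  | nil (s : Bool) (v : V) : GPath M 0 s v s v
  | cons {n : ℕ} {s : Bool} {v : V} {t : Bool} {w : V} (h : M s v ≠ v)
      (p : GPath M n (!s) (M s v) t w) : GPath M (n + 1) s v t w

namespace GPath

variable {V W : Type} {M : Bool → V → V} {N : Bool → W → W}

theorem trans {n m : ℕ} {s t u : Bool} {a b c : V} (p : GPath M n s a t b)
    (q : GPath M m t b u c) : GPath M (n + m) s a u c := by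
  induction p with
  | nil s v => simpa using q
  | cons h p ih =>
    have := GPath.cons h (ih q)
    rwa [Nat.add_right_comm] at this

theorem snoc {n : ℕ} {s t : Bool} {a b : V} (p : GPath M n s a t b) (h : M t b ≠ b) :
    GPath M (n + 1) s a (!t) (M t b) :=
  p.trans (GPath.cons h (GPath.nil _ _))

theorem snoc_inv {n : ℕ} {s t : Bool} {a c : V} (p : GPath M (n + 1) s a t c) :
    ∃ b, GPath M n s a (!t) b ∧ M (!t) b = c ∧ c ≠ b := by
  induction n generalizing s a with
  | zero =>
    cases p with
    | cons h p =>
      cases p with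
      | nil => exact ⟨a, by simpa using GPath.nil s a, by simp, h⟩
  | succ n ih =>
    cases p with
    | cons h p =>
      obtain ⟨b, hb, h1, h2⟩ := ih p
      exact ⟨b, GPath.cons h hb, h1, h2⟩

theorem map {n : ℕ} {s t : Bool} {a b : V} (φ : V → W) (hφ : Function.Injective φ)
    (hN : ∀ s v, M s v ≠ v → N s (φ v) = φ (M s v)) (p : GPath M n s a t b) :
    GPath N n s (φ a) t (φ b) := by
  induction p with
  | nil s v => exact GPath.nil _ _
  | cons h p ih =>
    rw [← hN _ _ h] at ih
    refine GPath.cons ?_ ih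
    rw [hN _ _ h]
    exact fun h' => h (hφ h')

theorem rev {n : ℕ} {s t : Bool} {a b : V} (hM : ∀ s, Function.Involutive (M s))
    (p : GPath M n s a t b) : GPath M n (!t) b (!s) a := by
  induction p with
  | nil s v => exact GPath.nil _ _
  | @cons n s v t w h p ih =>
    have h2 : M (!!s) (M s v) = v := by simpa using hM s v
    have := ih.snoc (by rw [h2]; exact h.symm)
    rw [h2] at this
    simpa using this

theorem no_return (hM : ∀ s, Function.Involutive (M s)) (n : ℕ) :
    ∀ s a, ¬ GPath M n s a (!s) a := by
  induction n using Nat.strong_induction_on with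
  | _ n ih =>
    intro s a p
    cases n with
    | zero => cases hs : s <;> subst hs <;> cases p
    | succ n =>
      cases p with
      | cons h p =>
        cases n with
        | zero =>
          generalize hb : M s a = b at p h
          cases p
          exact h rfl
        | succ n =>
          obtain ⟨b, hb, h1, h2⟩ := p.snoc_inv
          rw [Bool.not_not] at h1
          have : b = M s a := by rw [← h1, hM s b]
          subst this
          exact ih n (by omega) _ _ hb

end GPath

/-- The two matchings combined. -/
def ghM {V : Type} (a b : V → V) (s : Bool) : V → V := if s then b else a

@[simp] theorem ghM_false {V : Type} (a b : V → V) : ghM a b false = a := rfl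
@[simp] theorem ghM_true {V : Type} (a b : V → V) : ghM a b true = b := rfl

theorem ghM_inv {V : Type} {a b : V → V} (ha : Function.Involutive a)
    (hb : Function.Involutive b) (s : Bool) : Function.Involutive (ghM a b s) := by
  cases s <;> simpa

theorem optMap_inv {V : Type} {b : V → V} (hb : Function.Involutive b) :
    Function.Involutive (Option.map b) := by
  intro v
  cases v <;> simp [hb _]

theorem ghStep_eq {s : ℕ} (A : Option (Fin s) → Option (Fin s)) (B : Fin s → Fin s) (n : ℕ)
    (v : Option (Fin s)) :
    ghStep A B n v = ghM A (Option.map B) (decide (n % 2 = 1)) v := by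
  unfold ghStep ghM
  rcases Nat.mod_two_eq_zero_or_one n with h | h <;> simp [h]

theorem decide_succ_odd (n : ℕ) : decide ((n + 1) % 2 = 1) = !decide (n % 2 = 1) := by
  rcases Nat.mod_two_eq_zero_or_one n with h | h
  · have : (n + 1) % 2 = 1 := by omega
    simp [h, this]
  · have : (n + 1) % 2 = 0 := by omega
    simp [h, this]

/-- A computing protocol yields a path. -/
theorem GHProtocol.Computes.path {X Y : Type} {s : ℕ} {P : GHProtocol X Y s}
    {f : X → Y → Bool} (h : P.Computes f) (x : X) (y : Y) :
    ∃ n w, GPath (ghM (P.A x) (Option.map (P.B y))) n false none (f x y) w ∧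
      ghM (P.A x) (Option.map (P.B y)) (f x y) w = w := by
  obtain ⟨h1, h2⟩ := h x y
  have hmem := Nat.sInf_mem h1
  change ghStep _ _ (ghLen _ _) _ = _ at hmem
  have hf : f x y = decide (ghLen (P.A x) (P.B y) % 2 = 1) := by
    rw [Bool.eq_iff_iff, ← h2]; simp
  have key : ∀ i ≤ ghLen (P.A x) (P.B y),
      GPath (ghM (P.A x) (Option.map (P.B y))) i false none (decide (i % 2 = 1))
        (ghWalk (P.A x) (P.B y) i) := by
    intro i
    induction i with
    | zero => intro _; exact GPath.nil _ _
    | succ i ih =>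
      intro hi
      have hn := Nat.notMem_of_lt_sInf (show i < sInf _ from hi)
      have := (ih (by omega)).snoc (by rw [← ghStep_eq]; exact hn)
      rw [decide_succ_odd, ghWalk, ghStep_eq]
      exact this
  refine ⟨ghLen (P.A x) (P.B y), ghWalk (P.A x) (P.B y) (ghLen (P.A x) (P.B y)), ?_, ?_⟩
  · rw [hf]; exact key _ le_rfl
  · rw [hf, ← ghStep_eq]; exact hmem

theorem walk_of_path {s : ℕ} {A : Option (Fin s) → Option (Fin s)} {B : Fin s → Fin s}
    {n : ℕ} {t u : Bool} {v w : Option (Fin s)}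
    (p : GPath (ghM A (Option.map B)) n t v u w) :
    ∀ m, ghWalk A B m = v → t = decide (m % 2 = 1) →
      ghWalk A B (m + n) = w ∧ u = decide ((m + n) % 2 = 1) ∧
      ∀ i, m ≤ i → i < m + n → ghStep A B i (ghWalk A B i) ≠ ghWalk A B i := by
  induction p with
  | nil s v => intro m h1 h2; exact ⟨h1, h2, fun i _ _ => by omega⟩
  | cons h p ih =>
    intro m h1 h2
    obtain ⟨a1, a2, a3⟩ := ih (m + 1) (by rw [ghWalk, ghStep_eq, h1, h2])
      (by rw [decide_succ_odd, h2])
    rw [Nat.add_assoc, Nat.add_comm 1] at a1 a2 a3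
    refine ⟨a1, a2, fun i hi1 hi2 => ?_⟩
    rcases Nat.eq_or_lt_of_le hi1 with rfl | hlt
    · rw [ghStep_eq, h1, ← h2]; exact h
    · exact a3 i hlt hi2

theorem computes_of_path {X Y : Type} {s : ℕ} {P : GHProtocol X Y s}
    {f : X → Y → Bool}
    (h : ∀ x y, ∃ n w, GPath (ghM (P.A x) (Option.map (P.B y))) n false none (f x y) w ∧
      ghM (P.A x) (Option.map (P.B y)) (f x y) w = w) : P.Computes f := by
  intro x y
  obtain ⟨n, w, hp, hw⟩ := h x y
  obtain ⟨a1, a2, a3⟩ := walk_of_path hp 0 rfl (by simp)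
  rw [Nat.zero_add] at a1 a2 a3
  have hn : n ∈ {n | ghStep (P.A x) (P.B y) n (ghWalk (P.A x) (P.B y) n)
        = ghWalk (P.A x) (P.B y) n} := by
    change ghStep _ _ _ _ = _
    rw [ghStep_eq, a1, ← a2, hw]
  have hl : ghLen (P.A x) (P.B y) = n := by
    apply le_antisymm (Nat.sInf_le hn)
    by_contra hlt
    exact a3 _ (Nat.zero_le _) (not_le.mp hlt) (Nat.sInf_mem ⟨n, hn⟩)
  exact ⟨⟨n, hn⟩, by rw [hl, a2]; simp⟩

theorem const_of_zero {X Y : Type} {s : ℕ} (hs : s = 0) {P : GHProtocol X Y s}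
    {f : X → Y → Bool} (h : P.Computes f) (x : X) (y : Y) : f x y = false := by
  subst hs
  obtain ⟨n, w, hp, hw⟩ := h.path x y
  generalize f x y = b at hp
  cases hp with
  | nil => rfl
  | cons h p => exact absurd (Subsingleton.elim _ _) h

/-- Systems with two entries, computing `h false` and `h true` from these entries. -/
def GSys (X Y : Type) (n : ℕ) (h : Bool → X → Y → Bool) : Prop :=
  ∃ (V : Type) (_ : Fintype V) (A : X → V → V) (B : Y → V → V) (e : Bool → V),
    Fintype.card V ≤ n ∧ (∀ x, Function.Involutive (A x)) ∧ (∀ y, Function.Involutive (B y)) ∧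
    Function.Injective e ∧ (∀ y j, B y (e j) = e j) ∧
    ∀ x y j, ∃ m w, GPath (ghM (A x) (B y)) m false (e j) (h j x y) w ∧
      ghM (A x) (B y) (h j x y) w = w ∧ (h j x y = true → ∀ i, w ≠ e i)

theorem GSys.mono {X Y : Type} {n m : ℕ} {h h' : Bool → X → Y → Bool} (H : GSys X Y n h)
    (hn : n ≤ m) (hh : ∀ j x y, h j x y = h' j x y) : GSys X Y m h' := by
  have : h = h' := by funext j x y; exact hh j x y
  subst this
  obtain ⟨V, i, A, B, e, h1, h2⟩ := H
  exact ⟨V, i, A, B, e, h1.trans hn, h2⟩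

theorem GSys.const (X Y : Type) : GSys X Y 3 (fun j _ _ => j) := by
  refine ⟨Fin 3, inferInstance, fun _ => Equiv.swap 1 2, fun _ v => v,
    fun j => if j then 1 else 0, by simp, fun x v => by simp, fun y v => rfl,
    by decide, fun _ _ => rfl, ?_⟩
  intro x y j
  cases j
  · exact ⟨0, 0, GPath.nil _ _, by simp; decide, by simp⟩
  · refine ⟨1, 2, GPath.cons (by simp) ?_, by simp, fun _ i => by revert i; decide⟩
    exact GPath.nil _ _

theorem GSys.reset {X Y : Type} {n : ℕ} {h : Bool → X → Y → Bool} (H : GSys X Y n h)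
    (j b : Bool) : GSys X Y (n + 2) (fun i x y => if i then b else h j x y) := by
  obtain ⟨V, _, A, B, e, h1, h2, h3, h4, h5, h6⟩ := H
  refine ⟨V ⊕ Bool, inferInstance,
    fun x => Sum.map (A x) (fun c => if b then !c else c),
    fun y => Sum.map (B y) id,
    fun i => if i then Sum.inr true else Sum.inl (e j), by simpa using h1, ?_, ?_, ?_, ?_, ?_⟩
  · rintro x (v | c)
    · simp [h2 x v]
    · cases b <;> simp
  · rintro y (v | c)
    · simp [h3 y v]
    · simp
  · intro i i'
    cases i <;> cases i' <;> simp
  · intro y i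
    cases i <;> simp [h5]
  · intro x y i
    cases i
    · obtain ⟨m, w, p, hw, hn⟩ := h6 x y j
      refine ⟨m, Sum.inl w, ?_, ?_, ?_⟩
      · refine p.map Sum.inl Sum.inl_injective ?_
        intro s v _
        cases s <;> rfl
      · simp only [Bool.false_eq_true, if_false]
        generalize h j x y = t at hw
        cases t <;> simpa using hw
      · intro ht i
        have := hn (by simpa using ht) j
        cases i <;> simpa using this
    · cases b
      · exact ⟨0, Sum.inr true, GPath.nil _ _, by simp, by simp⟩
      · refine ⟨1, Sum.inr false, GPath.cons (by simp) (GPath.nil _ _), by simp, ?_⟩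
        intro _ i
        cases i <;> simp

/-- Matching of Alice in the four-copy gadget. -/
noncomputable def gadA {S V : Type} (a : Option S → Option S) (a₂ : V → V) :
    (Bool × Bool × Option S) ⊕ V → (Bool × Bool × Option S) ⊕ V :=
  open Classical in
  Sum.map (fun p => if a p.2.2 = p.2.2 then (!p.1, p.2.1, p.2.2) else (p.1, p.2.1, a p.2.2))
    a₂

/-- Matching of Bob in the four-copy gadget. -/
noncomputable def gadB {S V : Type} (b : S → S) (b' : V → V) (e : Bool → V) :
    (Bool × Bool × Option S) ⊕ V → (Bool × Bool × Option S) ⊕ V :=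
  open Classical in
  fun
  | Sum.inl (io, j, some v) =>
    if b v = v then Sum.inl (!io, !j, some v) else Sum.inl (io, j, some (b v))
  | Sum.inl (false, j, none) => Sum.inl (false, j, none)
  | Sum.inl (true, j, none) => Sum.inr (e j)
  | Sum.inr v =>
    if v = e false then Sum.inl (true, false, none)
    else if v = e true then Sum.inl (true, true, none) else Sum.inr (b' v)

theorem gadA_inv {S V : Type} {a : Option S → Option S} {a' : V → V}
    (ha : Function.Involutive a) (ha' : Function.Involutive a') :
    Function.Involutive (gadA a a') := by
  rintro (⟨io, j, v⟩ | v)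
  · by_cases h : a v = v
    · simp [gadA, h]
    · have : ¬ v = a v := fun h' => h h'.symm
      simp [gadA, h, ha v, this]
  · simp [gadA, ha' v]

theorem gadB_inv {S V : Type} {b : S → S} {b' : V → V} {e : Bool → V}
    (hb : Function.Involutive b) (hb' : Function.Involutive b')
    (he : Function.Injective e) (hbe : ∀ j, b' (e j) = e j) :
    Function.Involutive (gadB b b' e) := by
  have hne : e true ≠ e false := fun h => by simpa using he h
  rintro (⟨io, j, v⟩ | v)
  · cases v with
    | none => cases io <;> cases j <;> simp [gadB, hne]
    | some v =>
      by_cases h : b v = v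
      · simp [gadB, h]
      · have : ¬ v = b v := fun h' => h h'.symm
        simp [gadB, h, hb v, this]
  · by_cases h0 : v = e false
    · simp [gadB, h0]
    · by_cases h1 : v = e true
      · simp [gadB, h1, hne]
      · have k : ∀ j, b' v = e j → v = e j := fun j h => by
          rw [← hb' v, h, hbe]
        have k0 : ¬ b' v = e false := fun h => h0 (k _ h)
        have k1 : ¬ b' v = e true := fun h => h1 (k _ h)
        simp [gadB, h0, h1, k0, k1, hb' v]

theorem GSys.gadget {X Y : Type} {n s : ℕ} {h : Bool → X → Y → Bool} (H : GSys X Y n h)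
    {f : X → Y → Bool} {P : GHProtocol X Y s} (hP : P.Computes f) :
    GSys X Y (n + 4 * (s + 1)) (fun j x y => h (xor j (f x y)) x y) := by
  obtain ⟨V, _, A, B, e, h1, h2, h3, h4, h5, h6⟩ := H
  refine ⟨(Bool × Bool × Option (Fin s)) ⊕ V, inferInstance,
    fun x => gadA (P.A x) (A x), fun y => gadB (P.B y) (B y) e,
    fun j => Sum.inl (false, j, none), ?_, fun x => gadA_inv (P.hA x) (h2 x),
    fun y => gadB_inv (P.hB y) (h3 y) h4 (h5 y), ?_, ?_, ?_⟩
  · simp; omega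
  · intro j j' hj; simpa using hj
  · intro y j; rfl
  · intro x y j
    obtain ⟨m, w, p, hw⟩ := hP.path x y
    have hinv := ghM_inv (P.hA x) (optMap_inv (P.hB y))
    have hne : e true ≠ e false := fun h => by simpa using h4 h
    set N := ghM (gadA (P.A x) (A x)) (gadB (P.B y) (B y) e) with hN
    have hcopy : ∀ io j, ∀ s v, ghM (P.A x) (Option.map (P.B y)) s v ≠ v →
        N s (Sum.inl (io, j, v)) =
          Sum.inl (io, j, ghM (P.A x) (Option.map (P.B y)) s v) := by
      intro io j s v hv
      cases s
      · simp only [ghM_false] at hv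
        simp [hN, gadA, hv]
      · cases v with
        | none => simp at hv
        | some v =>
          simp only [ghM_true, Option.map_some, ne_eq, Option.some.injEq] at hv
          simp [hN, gadB, hv]
    have hinj : ∀ io j, Function.Injective
        (fun v => (Sum.inl (io, j, v) : (Bool × Bool × Option (Fin s)) ⊕ V)) := by
      intro io j v v' hv
      simpa using hv
    have p1 := p.map (N := N) _ (hinj false j) (hcopy false j)
    have p2 := (p.rev hinv).map (N := N) _ (hinj true (xor j (f x y)))
      (hcopy true (xor j (f x y)))
    have hmid : N (f x y) (Sum.inl (false, j, w)) = Sum.inl (true, xor j (f x y), w) := by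
      generalize hfb : f x y = fb at p hw
      cases fb
      · simp only [ghM_false] at hw
        simp [hN, gadA, hw]
      · cases w with
        | none => exact absurd p (GPath.no_return hinv _ _ _)
        | some w =>
          simp only [ghM_true, Option.map_some, Option.some.injEq] at hw
          simp [hN, gadB, hw]
    have p3 := p1.snoc (by rw [hmid]; simp)
    rw [hmid] at p3
    have p4 := p3.trans p2
    have hout : ∀ i, N true (Sum.inl (true, i, none)) = Sum.inr (e i) := by
      intro i; simp [hN, gadB]
    have p5 := p4.snoc (by rw [Bool.not_false, hout]; simp)
    rw [Bool.not_false, hout, Bool.not_true] at p5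
    obtain ⟨m', w', q, hw', hn'⟩ := h6 x y (xor j (f x y))
    have q1 := q.map (N := N) Sum.inr Sum.inr_injective (by
      intro s v hv
      cases s
      · simp [hN, gadA]
      · simp only [ghM_true] at hv
        have k : ∀ i, ¬ v = e i := by
          rintro i rfl
          exact hv (h5 y i)
        simp [hN, gadB, k])
    refine ⟨_, Sum.inr w', p5.trans q1, ?_, fun _ i => by simp⟩
    change N (h (xor j (f x y)) x y) (Sum.inr w') = Sum.inr w'
    generalize h (xor j (f x y)) x y = t at hw' hn' ⊢
    cases t
    · simp only [ghM_false] at hw'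
      simp [hN, gadA, hw']
    · simp only [ghM_true] at hw'
      have := hn' rfl
      simp [hN, gadB, this, hw']

theorem GSys.final {X Y : Type} {n : ℕ} {h : Bool → X → Y → Bool} (H : GSys X Y n h) :
    ∃ s ≤ n + 1, ∃ P : GHProtocol X Y s, P.Computes (h false) := by
  classical
  obtain ⟨V, _, A, B, e, h1, h2, h3, h4, h5, h6⟩ := H
  let g : Option V ≃ Fin (Fintype.card (Option V)) := Fintype.equivFin _
  let A' : X → Option (Option V) → Option (Option V) := fun x v =>
    match v with
    | none => some none
    | some none => none
    | some (some v) => some (some (A x v))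
  let B' : Y → Option V → Option V := fun y v =>
    match v with
    | none => some (e false)
    | some v => if v = e false then none else some (B y v)
  have hA' : ∀ x, Function.Involutive (A' x) := by
    rintro x (_ | _ | v)
    · rfl
    · rfl
    · simp [A', h2 x v]
  have hB' : ∀ y, Function.Involutive (B' y) := by
    rintro y (_ | v)
    · simp [B']
    · by_cases hv : v = e false
      · simp [B', hv]
      · have : ¬ B y v = e false := fun hh => hv (by rw [← h3 y v, hh, h5])
        simp [B', hv, this, h3 y v]
  refine ⟨Fintype.card (Option V), by simpa using h1,
    ⟨fun x v => (A' x (v.map g.symm)).map g, fun y v => g (B' y (g.symm v)), ?_, ?_⟩, ?_⟩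
  · intro x v
    simp [hA' x _]
  · intro y v
    simp [hB' y _]
  · apply computes_of_path
    intro x y
    obtain ⟨m, w, p, hw, hn⟩ := h6 x y false
    set N := ghM (A' x) (Option.map (B' y)) with hN
    have q := p.map (N := N) (fun v => some (some v)) (fun v v' hv => by simpa using hv) (by
      intro s v hv
      cases s
      · simp [hN, A']
      · simp only [ghM_true] at hv
        have k : ¬ v = e false := by
          rintro rfl
          exact hv (h5 y _)
        simp [hN, B', k])
    have q0 : GPath N 2 false none false (some (some (e false))) :=
      GPath.cons (by simp [hN, A']) (GPath.cons (by simp [hN, A', B']) (GPath.nil _ _))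
    have q1 := q0.trans q
    have hc : ∀ s v, ghM (fun v => (A' x (v.map g.symm)).map g)
        (Option.map fun v => g (B' y (g.symm v))) s (Option.map g v) =
        Option.map g (N s v) := by
      intro s v
      cases s
      · simp [hN]
      · cases v <;> simp [hN]
    have q2 := q1.map (Option.map g) (Option.map_injective g.injective) (fun s v _ => hc s v)
    refine ⟨_, _, q2, ?_⟩
    refine (hc _ _).trans ?_
    congr 1
    generalize h false x y = t at hw hn
    cases t
    · simp only [ghM_false] at hw
      simp [hN, A', hw]
    · simp only [ghM_true] at hw
      have := hn rfl
      simp [hN, B', this, hw]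

theorem GSys.or {X Y : Type} (k : ℕ) (f : Fin k → X → Y → Bool) (c : Fin k → ℕ)
    (hf : ∀ i, ∃ P : GHProtocol X Y (c i), P.Computes (f i)) :
    GSys X Y (10 * ∑ i, c i + 5)
      (fun j x y => if j then true else decide (∃ i, f i x y = true)) := by
  induction k with
  | zero => exact (GSys.const X Y).mono (by omega) (by intro j x y; cases j <;> simp)
  | succ k ih =>
    have ih := ih (fun i => f i.succ) (fun i => c i.succ) (fun i => hf i.succ)
    obtain ⟨P, hP⟩ := hf 0
    rw [Fin.sum_univ_succ]
    by_cases h0 : c 0 = 0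
    · refine ih.mono (by omega) ?_
      intro j x y
      simp [Fin.exists_fin_succ, const_of_zero h0 hP]
    · refine ((ih.gadget hP).reset false true).mono (by omega) ?_
      intro j x y
      cases j <;> cases hfx : f 0 x y <;> simp [Fin.exists_fin_succ, hfx]

theorem GSys.and {X Y : Type} (k : ℕ) (f : Fin k → X → Y → Bool) (c : Fin k → ℕ)
    (hf : ∀ i, ∃ P : GHProtocol X Y (c i), P.Computes (f i)) :
    GSys X Y (10 * ∑ i, c i + 5)
      (fun j x y => if j then false else decide (∀ i, f i x y = true)) := by
  induction k with
  | zero =>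
    exact ((GSys.const X Y).reset true false).mono (by omega)
      (by intro j x y; cases j <;> simp)
  | succ k ih =>
    have ih := ih (fun i => f i.succ) (fun i => c i.succ) (fun i => hf i.succ)
    obtain ⟨P, hP⟩ := hf 0
    rw [Fin.sum_univ_succ]
    by_cases h0 : c 0 = 0
    · refine ((GSys.const X Y).reset false false).mono (by omega) ?_
      intro j x y
      simp [Fin.forall_fin_succ, const_of_zero h0 hP]
    · refine ((ih.gadget hP).reset true false).mono (by omega) ?_
      intro j x y
      cases j <;> cases hfx : f 0 x y <;> simp [Fin.forall_fin_succ, hfx]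

theorem GSys.xor {X Y : Type} (k : ℕ) (f : Fin k → X → Y → Bool) (c : Fin k → ℕ)
    (hf : ∀ i, ∃ P : GHProtocol X Y (c i), P.Computes (f i)) :
    GSys X Y (10 * ∑ i, c i + 5)
      (fun j x y => Bool.xor j
        (decide (Odd (Finset.univ.filter fun i => f i x y = true).card))) := by
  induction k with
  | zero => exact (GSys.const X Y).mono (by omega) (by intro j x y; cases j <;> simp)
  | succ k ih =>
    have ih := ih (fun i => f i.succ) (fun i => c i.succ) (fun i => hf i.succ)
    obtain ⟨P, hP⟩ := hf 0
    rw [Fin.sum_univ_succ]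
    by_cases h0 : c 0 = 0
    · refine ih.mono (by omega) ?_
      intro j x y
      simp [Fin.card_filter_univ_succ, const_of_zero h0 hP]
    · refine (ih.gadget hP).mono (by omega) ?_
      intro j x y
      rw [Fin.card_filter_univ_succ]
      cases j <;> cases hfx : f 0 x y <;> simp [Nat.odd_add_one, -Nat.not_odd_iff_even]

/-- If `f₁, …, f_k` have garden-hose complexities `c₁, …, c_k` (their inputs may
be distributed arbitrarily between Alice and Bob), then the OR, the AND and the
XOR of `f₁, …, f_k` all have garden-hose complexity `O(Σᵢ cᵢ)`. -/
theorem GH_compose_or_and_xor :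
    ∃ C : ℕ, 0 < C ∧
      ∀ (X Y : Type) (k : ℕ) (f : Fin k → X → Y → Bool) (c : Fin k → ℕ),
        (∀ i, ∃ P : GHProtocol X Y (c i), P.Computes (f i)) →
        (∃ s ≤ C * (∑ i, c i + 1), ∃ P : GHProtocol X Y s,
          P.Computes (fun x y => decide (∃ i, f i x y = true))) ∧
        (∃ s ≤ C * (∑ i, c i + 1), ∃ P : GHProtocol X Y s,
          P.Computes (fun x y => decide (∀ i, f i x y = true))) ∧
        (∃ s ≤ C * (∑ i, c i + 1), ∃ P : GHProtocol X Y s,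
          P.Computes (fun x y =>
            decide (Odd (Finset.univ.filter fun i => f i x y = true).card))) := by
  refine ⟨10, by norm_num, fun X Y k f c hf => ⟨?_, ?_, ?_⟩⟩
  · obtain ⟨s, hs, P, hP⟩ := (GSys.or k f c hf).final
    exact ⟨s, by omega, P, by simpa using hP⟩
  · obtain ⟨s, hs, P, hP⟩ := (GSys.and k f c hf).final
    exact ⟨s, by omega, P, by simpa using hP⟩
  · obtain ⟨s, hs, P, hP⟩ := (GSys.xor k f c hf).final
    exact ⟨s, by omega, P, by simpa using hP⟩
end

section
/- If f₁,…,f_k are Boolean functions with garden-hose complexities GH(fᵢ), then GH(MAJ(f₁,…,f_k)) = O((Σᵢ GH(fᵢ)) · log³ k), where MAJ(z₁,…,z_k) = 1 iff Σᵢ zᵢ ≥ k/2. -/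
namespace GHMaj

/-- The involution applied at side `b` (`false` for Alice, `true` for Bob). -/
def stp {V : Type} (A : Option V → Option V) (B : V → V) (p : Bool × Option V) : Option V :=
  if p.1 = true then p.2.map B else A p.2

/-- One non-halting step of the water. -/
def Rel {V : Type} (A : Option V → Option V) (B : V → V) (p q : Bool × Option V) : Prop :=
  stp A B p ≠ p.2 ∧ q = (!p.1, stp A B p)

theorem build {X Y V : Type} [Fintype V] (A : X → Option V → Option V) (B : Y → V → V)
    (hA : ∀ x, Function.Involutive (A x)) (hB : ∀ y, Function.Involutive (B y))
    (f : X → Y → Bool)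
    (h : ∀ x y, ∃ u, Relation.ReflTransGen (Rel (A x) (B y)) (false, none) (f x y, u) ∧
      stp (A x) (B y) (f x y, u) = u) :
    ∃ P : GHProtocol X Y (Fintype.card V), P.Computes f := by
  let e := Fintype.equivFin V
  let e' : Option V ≃ Option (Fin (Fintype.card V)) := Equiv.optionCongr e
  refine ⟨⟨fun x v => e' (A x (e'.symm v)), fun y v => e (B y (e.symm v)), ?_, ?_⟩, ?_⟩
  · intro x v
    simp [hA x _]
  · intro y v
    simp [hB y _]
  intro x y
  dsimp only
  set A' : Option (Fin (Fintype.card V)) → Option (Fin (Fintype.card V)) :=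
    fun v => e' (A x (e'.symm v)) with hA'
  set B' : Fin (Fintype.card V) → Fin (Fintype.card V) := fun v => e (B y (e.symm v)) with hB'
  have hstep : ∀ (n : ℕ) (b : Bool) (u : Option V), (n % 2 = if b then 1 else 0) →
      ghStep A' B' n (e' u) = e' (stp (A x) (B y) (b, u)) := by
    intro n b u hn
    cases b
    · simp at hn
      simp [ghStep, stp, hn, hA']
    · simp at hn
      cases u <;> simp [ghStep, stp, hn, hB', e']
  have key : ∀ p : Bool × Option V, Relation.ReflTransGen (Rel (A x) (B y)) (false, none) p →
      ∃ n, (n % 2 = if p.1 then 1 else 0) ∧ ghWalk A' B' n = e' p.2 ∧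
        ∀ m < n, ghStep A' B' m (ghWalk A' B' m) ≠ ghWalk A' B' m := by
    intro p hp
    induction hp with
    | refl => exact ⟨0, by simp, by simp [ghWalk, e'], by simp⟩
    | @tail p q _ hpq ih =>
      obtain ⟨n, hn, hw, hlt⟩ := ih
      obtain ⟨hne, rfl⟩ := hpq
      have hs := hstep n p.1 p.2 hn
      refine ⟨n + 1, ?_, ?_, ?_⟩
      · cases hp1 : p.1 <;> simp [hp1] at hn ⊢ <;> omega
      · simp only [ghWalk]
        rw [hw, hs]
      · intro m hm
        rcases Nat.lt_succ_iff_lt_or_eq.mp hm with h1 | h1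
        · exact hlt m h1
        · subst h1
          rw [hw, hs]
          intro hc
          exact hne (e'.injective hc)
  obtain ⟨u, hr, hh⟩ := h x y
  obtain ⟨n, hn, hw, hlt⟩ := key _ hr
  have hmem : ghStep A' B' n (ghWalk A' B' n) = ghWalk A' B' n := by
    rw [hw, hstep n _ u hn, hh]
  have hlen : ghLen A' B' = n := by
    unfold ghLen
    refine le_antisymm (Nat.sInf_le hmem) ?_
    refine le_csInf ⟨n, hmem⟩ ?_
    intro m hm
    by_contra hc
    exact hlt m (by omega) hm
  refine ⟨⟨n, hmem⟩, ?_⟩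
  rw [hlen, hn]
  cases f x y <;> simp

/-- A non-halting walk never arrives at the tap on Bob's side. -/
theorem walk_odd_ne_none {s : ℕ} (A : Option (Fin s) → Option (Fin s)) (B : Fin s → Fin s)
    (hA : Function.Involutive A) (hB : Function.Involutive B) (n : ℕ) (hn : n % 2 = 1)
    (hlt : ∀ m < n, ghStep A B m (ghWalk A B m) ≠ ghWalk A B m) : ghWalk A B n ≠ none := by
  intro h0
  have hinv : ∀ m v, ghStep A B m (ghStep A B m v) = v := by
    intro m v
    unfold ghStep
    split_ifs
    · exact hA v
    · cases v <;> simp [hB _]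
  have hpar : ∀ m m' v, m % 2 = m' % 2 → ghStep A B m v = ghStep A B m' v := by
    intro m m' v h
    simp [ghStep, h]
  have key : ∀ j ≤ n, ghWalk A B (n - j) = ghWalk A B j := by
    intro j
    induction j with
    | zero => intro _; simpa [ghWalk] using h0
    | succ j ih =>
      intro hj
      have h1 := ih (by omega)
      have h2 : n - j = (n - (j + 1)) + 1 := by omega
      rw [h2] at h1
      simp only [ghWalk] at h1 ⊢
      rw [← h1, hpar j (n - (j + 1)) _ (by omega), hinv]
  have h3 := key (n / 2) (by omega)
  have h4 : n - n / 2 = n / 2 + 1 := by omega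
  rw [h4] at h3
  exact hlt (n / 2) (by omega) h3

/-- The pipes of the composed protocol. -/
inductive Pipe (T w : ℕ) (m : Fin T → ℕ) : Type
  | start : Pipe T w m
  | rej (τ : Fin T) (s : Fin w) : Pipe T w m
  | cp (d : Bool) (τ : Fin T) (s : Fin w) (v : Option (Fin (m τ))) : Pipe T w m

def pipeEquiv (T w : ℕ) (m : Fin T → ℕ) :
    Pipe T w m ≃ Unit ⊕ (Fin T × Fin w) ⊕ (Bool × Fin w × (Σ τ : Fin T, Option (Fin (m τ)))) where
  toFun p := match p with
    | .start => Sum.inl ()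
    | .rej τ s => Sum.inr (Sum.inl (τ, s))
    | .cp d τ s v => Sum.inr (Sum.inr (d, s, ⟨τ, v⟩))
  invFun q := match q with
    | Sum.inl _ => .start
    | Sum.inr (Sum.inl (τ, s)) => .rej τ s
    | Sum.inr (Sum.inr (d, s, ⟨τ, v⟩)) => .cp d τ s v
  left_inv p := by cases p <;> rfl
  right_inv q := by
    rcases q with _ | ⟨_, _⟩ | ⟨_, _, _, _⟩ <;> rfl

instance (T w : ℕ) (m : Fin T → ℕ) : Fintype (Pipe T w m) :=
  Fintype.ofEquiv _ (pipeEquiv T w m).symm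

theorem card_pipe (T w : ℕ) (m : Fin T → ℕ) :
    Fintype.card (Pipe T w m) = 1 + (T * w + 2 * (w * ∑ τ, (m τ + 1))) := by
  rw [Fintype.card_congr (pipeEquiv T w m)]
  simp

/-- A layer of a program: the variable read, the permutation applied for each of its values,
and the exits taken after it. -/
structure Layer (ι : Type) (w : ℕ) where
  i : ι
  g : Bool → Equiv.Perm (Fin w)
  act : Fin w → Option Bool

def eval {ι : Type} {w : ℕ} (z : ι → Bool) : List (Layer ι w) → Fin w → Bool
  | [], _ => true
  | l :: L, s => match l.act (l.g (z l.i) s) with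
    | some b => b
    | none => eval z L (l.g (z l.i) s)

/-- Alice's matching in the composed protocol. -/
noncomputable def bigA {T w : ℕ} {m : Fin T → ℕ} (g : Fin T → Equiv.Perm (Fin w))
    (a : ∀ τ, Option (Fin (m τ)) → Option (Fin (m τ))) :
    Option (Pipe T w m) → Option (Pipe T w m)
  | none => some .start
  | some .start => none
  | some (.rej τ s) => some (.rej τ s)
  | some (.cp false τ s v) =>
      if a τ v = v then some (.cp true τ (g τ s) v) else some (.cp false τ s (a τ v))
  | some (.cp true τ s v) =>
      if a τ v = v then some (.cp false τ ((g τ)⁻¹ s) v) else some (.cp true τ s (a τ v))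

theorem bigA_inv {T w : ℕ} {m : Fin T → ℕ} (g : Fin T → Equiv.Perm (Fin w))
    (a : ∀ τ, Option (Fin (m τ)) → Option (Fin (m τ))) (ha : ∀ τ, Function.Involutive (a τ)) :
    Function.Involutive (bigA g a) := by
  intro p
  rcases p with _ | p
  · rfl
  · rcases p with _ | ⟨τ, s⟩ | ⟨d, τ, s, v⟩
    · rfl
    · rfl
    · have h := ha τ v
      cases d <;> by_cases hv : a τ v = v
      · simp [bigA, hv]
      · have hv' : ¬ v = a τ v := fun h => hv h.symm
        simp [bigA, hv, h, hv']
      · simp [bigA, hv]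
      · have hv' : ¬ v = a τ v := fun h => hv h.symm
        simp [bigA, hv, h, hv']

/-- Bob's matching in the composed protocol. -/
noncomputable def bigB {T w : ℕ} {m : Fin T → ℕ} (s0 : Fin w) (act : Fin T → Fin w → Option Bool)
    (g : Fin T → Equiv.Perm (Fin w))
    (b : ∀ τ, Fin (m τ) → Fin (m τ)) : Pipe T w m → Pipe T w m
  | .start => if h : 0 < T then .cp false ⟨0, h⟩ s0 none else .start
  | .rej τ s => if act τ s = some false then .cp true τ s none else .rej τ s
  | .cp false τ s (some v) =>
      if b τ v = v then .cp true τ (g τ s) (some v) else .cp false τ s (some (b τ v))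
  | .cp true τ s (some v) =>
      if b τ v = v then .cp false τ ((g τ)⁻¹ s) (some v) else .cp true τ s (some (b τ v))
  | .cp true τ s none =>
      if act τ s = some false then .rej τ s
      else if h : act τ s = none ∧ (τ : ℕ) + 1 < T then .cp false ⟨τ + 1, h.2⟩ s none
      else .cp true τ s none
  | .cp false ⟨0, h⟩ s none => if s = s0 then .start else .cp false ⟨0, h⟩ s none
  | .cp false ⟨n + 1, h⟩ s none =>
      if act ⟨n, by omega⟩ s = none then .cp true ⟨n, by omega⟩ s none
      else .cp false ⟨n + 1, h⟩ s none

theorem bigB_inv {T w : ℕ} {m : Fin T → ℕ} (s0 : Fin w) (act : Fin T → Fin w → Option Bool)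
    (g : Fin T → Equiv.Perm (Fin w))
    (b : ∀ τ, Fin (m τ) → Fin (m τ)) (hb : ∀ τ, Function.Involutive (b τ)) :
    Function.Involutive (bigB s0 act g b) := by
  intro p
  rcases p with _ | ⟨τ, s⟩ | ⟨d, τ, s, v⟩
  · by_cases h : 0 < T <;> simp [bigB, h]
  · by_cases h : act τ s = some false <;> simp [bigB, h]
  · rcases v with _ | v
    · cases d
      · rcases τ with ⟨_ | n, hn⟩
        · by_cases h : s = s0
          · simp [bigB, h, hn]
          · simp [bigB, h]
        · by_cases h : act ⟨n, by omega⟩ s = none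
          · simp [bigB, h, hn]
          · simp [bigB, h]
      · by_cases h : act τ s = some false
        · simp [bigB, h]
        · by_cases h' : act τ s = none ∧ (τ : ℕ) + 1 < T
          · simp [bigB, h']
          · simp [bigB, h, h']
    · have h := hb τ v
      cases d <;> by_cases hv : b τ v = v
      · simp [bigB, hv]
      · have hv' : ¬ v = b τ v := fun h => hv h.symm
        simp [bigB, hv, h, hv']
      · simp [bigB, hv]
      · have hv' : ¬ v = b τ v := fun h => hv h.symm
        simp [bigB, hv, h, hv']

theorem step_in {T w : ℕ} {m : Fin T → ℕ} (s0 : Fin w) (act : Fin T → Fin w → Option Bool)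
    (gA gB : Fin T → Equiv.Perm (Fin w))
    (a : ∀ τ, Option (Fin (m τ)) → Option (Fin (m τ))) (b : ∀ τ, Fin (m τ) → Fin (m τ))
    (d : Bool) (τ : Fin T) (s : Fin w) (j : ℕ) (v : Option (Fin (m τ)))
    (h : ghStep (a τ) (b τ) j v ≠ v) :
    Rel (bigA gA a) (bigB s0 act gB b) (decide (j % 2 = 1), some (.cp d τ s v))
      (decide (j % 2 = 0), some (.cp d τ s (ghStep (a τ) (b τ) j v))) := by
  unfold ghStep at h ⊢
  rcases Nat.mod_two_eq_zero_or_one j with hj | hj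
  · simp only [hj, if_true] at h ⊢
    cases d <;> simp [Rel, stp, bigA, h]
  · simp only [hj, one_ne_zero, if_false] at h ⊢
    rcases v with _ | v
    · simp at h
    · have h' : ¬ b τ v = v := by simpa using h
      cases d <;> simp [Rel, stp, bigB, h']

theorem layer_trav {T w : ℕ} {m : Fin T → ℕ} (s0 : Fin w) (act : Fin T → Fin w → Option Bool)
    (gA gB : Fin T → Equiv.Perm (Fin w))
    (a : ∀ τ, Option (Fin (m τ)) → Option (Fin (m τ))) (b : ∀ τ, Fin (m τ) → Fin (m τ))
    (ha : ∀ τ, Function.Involutive (a τ)) (hb : ∀ τ, Function.Involutive (b τ))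
    (τ : Fin T) (s : Fin w)
    (hne : {n | ghStep (a τ) (b τ) n (ghWalk (a τ) (b τ) n) = ghWalk (a τ) (b τ) n}.Nonempty)
    (z : Bool) (hz : ghLen (a τ) (b τ) % 2 = 1 ↔ z = true) :
    Relation.ReflTransGen (Rel (bigA gA a) (bigB s0 act gB b))
      (false, some (.cp false τ s none))
      (true, some (.cp true τ (if z = true then gB τ s else gA τ s) none)) := by
  set n := ghLen (a τ) (b τ) with hn
  have hhalt : ghStep (a τ) (b τ) n (ghWalk (a τ) (b τ) n) = ghWalk (a τ) (b τ) n :=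
    Nat.sInf_mem hne
  have hlt : ∀ j < n, ghStep (a τ) (b τ) j (ghWalk (a τ) (b τ) j) ≠ ghWalk (a τ) (b τ) j := by
    intro j hj hc
    have : n ≤ j := Nat.sInf_le hc
    omega
  have c1 : ∀ j ≤ n, Relation.ReflTransGen (Rel (bigA gA a) (bigB s0 act gB b))
      (false, some (.cp false τ s none))
      (decide (j % 2 = 1), some (.cp false τ s (ghWalk (a τ) (b τ) j))) := by
    intro j
    induction j with
    | zero => intro _; exact Relation.ReflTransGen.refl
    | succ j ih =>
      intro hj
      refine (ih (by omega)).tail ?_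
      have := step_in s0 act gA gB a b false τ s j _ (hlt j (by omega))
      have e : decide ((j + 1) % 2 = 1) = decide (j % 2 = 0) := by
        rw [decide_eq_decide]; omega
      rw [e]
      exact this
  have c2 : ∀ s' : Fin w, ∀ j ≤ n, Relation.ReflTransGen (Rel (bigA gA a) (bigB s0 act gB b))
      (decide (j % 2 = 0), some (.cp true τ s' (ghWalk (a τ) (b τ) j)))
      (true, some (.cp true τ s' none)) := by
    intro s' j
    induction j with
    | zero => intro _; exact Relation.ReflTransGen.refl
    | succ j ih =>
      intro hj
      refine Relation.ReflTransGen.head ?_ (ih (by omega))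
      have hinv : ghStep (a τ) (b τ) j (ghWalk (a τ) (b τ) (j + 1)) = ghWalk (a τ) (b τ) j := by
        simp only [ghWalk]
        unfold ghStep
        split_ifs
        · exact ha τ _
        · cases ghWalk (a τ) (b τ) j <;> simp [hb τ _]
      have hne' : ghStep (a τ) (b τ) j (ghWalk (a τ) (b τ) (j + 1)) ≠
          ghWalk (a τ) (b τ) (j + 1) := by
        rw [hinv]
        intro hc
        exact hlt j (by omega) hc.symm
      have := step_in s0 act gA gB a b true τ s' j _ hne'
      rw [hinv] at this
      have e : decide ((j + 1) % 2 = 0) = decide (j % 2 = 1) := by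
        rw [decide_eq_decide]; omega
      rw [e]
      exact this
  refine (c1 n le_rfl).trans (Relation.ReflTransGen.head ?_ (c2 _ n le_rfl))
  rcases Nat.mod_two_eq_zero_or_one n with h2 | h2
  · have hzf : z = false := by
      cases z
      · rfl
      · have := hz.mpr rfl
        omega
    have h3 : a τ (ghWalk (a τ) (b τ) n) = ghWalk (a τ) (b τ) n := by
      simpa [ghStep, h2] using hhalt
    simp [h2, hzf, Rel, stp, bigA, h3]
  · have hzt : z = true := hz.mp h2
    have h0 := walk_odd_ne_none (a τ) (b τ) (ha τ) (hb τ) n h2 hlt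
    obtain ⟨v, hv⟩ := Option.ne_none_iff_exists'.mp h0
    rw [hv] at hhalt ⊢
    have h3 : b τ v = v := by
      simpa [ghStep, h2] using hhalt
    simp [h2, hzt, Rel, stp, bigB, h3]

theorem gh_of_program {X Y ι : Type} {w : ℕ} (c : ι → ℕ) (f : ι → X → Y → Bool)
    (hP : ∀ i, ∃ P : GHProtocol X Y (c i), P.Computes (f i))
    (L : List (Layer ι w)) (s0 : Fin w) (hL : 0 < L.length) :
    ∃ P : GHProtocol X Y
        (1 + (L.length * w + 2 * (w * ∑ τ : Fin L.length, (c (L.get τ).i + 1)))),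
      P.Computes (fun x y => eval (fun i => f i x y) L s0) := by
  choose P hP using hP
  rw [← card_pipe L.length w (fun τ => c (L.get τ).i)]
  refine build (V := Pipe L.length w (fun τ => c (L.get τ).i))
    (fun x => bigA (fun τ => (L.get τ).g false) (fun τ => (P (L.get τ).i).A x))
    (fun y => bigB s0 (fun τ => (L.get τ).act) (fun τ => (L.get τ).g true)
      (fun τ => (P (L.get τ).i).B y))
    (fun x => bigA_inv _ _ (fun τ => (P (L.get τ).i).hA x))
    (fun y => bigB_inv _ _ _ _ (fun τ => (P (L.get τ).i).hB y)) _ ?_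
  intro x y
  set A' := bigA (fun τ => (L.get τ).g false) (fun τ => (P (L.get τ).i).A x) with hA'
  set B' := bigB s0 (fun τ => (L.get τ).act) (fun τ => (L.get τ).g true)
      (fun τ => (P (L.get τ).i).B y) with hB'
  have main : ∀ (n : ℕ) (τ : Fin L.length) (s : Fin w), τ + n + 1 = L.length →
      ∃ u, Relation.ReflTransGen (Rel A' B') (false, some (.cp false τ s none))
          (eval (fun i => f i x y) (L.drop τ) s, u) ∧
        stp A' B' (eval (fun i => f i x y) (L.drop τ) s, u) = u := by
    intro n
    induction n with
    | zero =>
      intro τ s hτ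
      have hd : L.drop τ = [L.get τ] := by
        rw [List.drop_eq_getElem_cons τ.2, List.drop_eq_nil_of_le (by omega)]
        rfl
      have ht := layer_trav s0 (fun τ => (L.get τ).act) (fun τ => (L.get τ).g false)
        (fun τ => (L.get τ).g true) (fun τ => (P (L.get τ).i).A x)
        (fun τ => (P (L.get τ).i).B y) (fun τ => (P (L.get τ).i).hA x)
        (fun τ => (P (L.get τ).i).hB y) τ s (hP _ x y).1 _ (hP _ x y).2
      rw [← hA', ← hB'] at ht
      have e1 : (if f (L.get τ).i x y = true then (L.get τ).g true s else (L.get τ).g false s)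
          = (L.get τ).g (f (L.get τ).i x y) s := by
        cases f (L.get τ).i x y <;> simp
      rw [e1] at ht
      rw [hd]
      simp only [eval]
      rcases hact : (L.get τ).act ((L.get τ).g (f (L.get τ).i x y) s) with _ | b
      · refine ⟨_, ht, ?_⟩
        have : ¬ ((τ : ℕ) + 1 < L.length) := by omega
        simp only [List.get_eq_getElem] at hact
        simp [stp, hB', bigB, hact, this]
      · cases b
        · refine ⟨some (.rej τ ((L.get τ).g (f (L.get τ).i x y) s)), ht.tail ?_, ?_⟩
          · simp only [List.get_eq_getElem] at hact
            simp [Rel, stp, hB', bigB, hact]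
          · simp [stp, hA', bigA]
        · refine ⟨_, ht, ?_⟩
          simp only [List.get_eq_getElem] at hact
          simp [stp, hB', bigB, hact]
    | succ n ih =>
      intro τ s hτ
      have hd : L.drop τ = L.get τ :: L.drop (τ + 1) := by
        rw [List.drop_eq_getElem_cons τ.2]
        rfl
      have ht := layer_trav s0 (fun τ => (L.get τ).act) (fun τ => (L.get τ).g false)
        (fun τ => (L.get τ).g true) (fun τ => (P (L.get τ).i).A x)
        (fun τ => (P (L.get τ).i).B y) (fun τ => (P (L.get τ).i).hA x)
        (fun τ => (P (L.get τ).i).hB y) τ s (hP _ x y).1 _ (hP _ x y).2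
      rw [← hA', ← hB'] at ht
      have e1 : (if f (L.get τ).i x y = true then (L.get τ).g true s else (L.get τ).g false s)
          = (L.get τ).g (f (L.get τ).i x y) s := by
        cases f (L.get τ).i x y <;> simp
      rw [e1] at ht
      rw [hd]
      simp only [eval]
      rcases hact : (L.get τ).act ((L.get τ).g (f (L.get τ).i x y) s) with _ | b
      · have hlt : (τ : ℕ) + 1 < L.length := by omega
        obtain ⟨u, hu1, hu2⟩ := ih ⟨τ + 1, hlt⟩ ((L.get τ).g (f (L.get τ).i x y) s)
          (by simp only; omega)
        refine ⟨u, (ht.tail ?_).trans hu1, hu2⟩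
        simp only [List.get_eq_getElem] at hact
        simp [Rel, stp, hB', bigB, hact, hlt]
      · cases b
        · refine ⟨some (.rej τ ((L.get τ).g (f (L.get τ).i x y) s)), ht.tail ?_, ?_⟩
          · simp only [List.get_eq_getElem] at hact
            simp [Rel, stp, hB', bigB, hact]
          · simp [stp, hA', bigA]
        · refine ⟨_, ht, ?_⟩
          simp only [List.get_eq_getElem] at hact
          simp [stp, hB', bigB, hact]
  obtain ⟨u, hu1, hu2⟩ := main (L.length - 1) ⟨0, hL⟩ s0 (by simp only; omega)
  refine ⟨u, ?_, hu2⟩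
  refine Relation.ReflTransGen.head (b := (true, some .start)) ?_
    (Relation.ReflTransGen.head (b := (false, some (.cp false ⟨0, hL⟩ s0 none))) ?_ hu1)
  · simp [Rel, stp, hA', bigA]
  · simp [Rel, stp, hB', bigB, hL]

def sweep {ι : Type} {w : ℕ} (l : List ι) (δ : Bool → ℤ) (ρ : Equiv.Perm (Fin w)) (n : ℤ) :
    List (Layer ι w) :=
  l.map fun i => ⟨i, fun b => ρ ^ (n * δ b), fun _ => none⟩

theorem eval_sweep {ι : Type} {w : ℕ} (z : ι → Bool) (l : List ι) (δ : Bool → ℤ)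
    (ρ : Equiv.Perm (Fin w)) (n : ℤ) (R : List (Layer ι w)) (s : Fin w) :
    eval z (sweep l δ ρ n ++ R) s =
      eval z R ((ρ ^ (n * (l.map fun i => δ (z i)).sum)) s) := by
  induction l generalizing s with
  | nil => simp [sweep]
  | cons i l ih =>
    have : sweep (i :: l) δ ρ n ++ R =
      ⟨i, fun b => ρ ^ (n * δ b), fun _ => none⟩ :: (sweep l δ ρ n ++ R) := rfl
    rw [this]
    simp only [eval]
    rw [ih, ← Equiv.Perm.mul_apply, ← zpow_add]
    congr 3
    simp only [List.map_cons, List.sum_cons]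
    ring

def fwd {ι : Type} {w : ℕ} (l : List ι) (δ : Bool → ℤ) (ρ : ℕ → Equiv.Perm (Fin w)) (a : ℕ → ℤ) :
    ℕ → List (Layer ι w)
  | 0 => []
  | m + 1 => fwd l δ ρ a m ++ sweep l δ (ρ m) (a m)

def bwd {ι : Type} {w : ℕ} (l : List ι) (δ : Bool → ℤ) (ρ : ℕ → Equiv.Perm (Fin w)) (a : ℕ → ℤ) :
    ℕ → List (Layer ι w)
  | 0 => []
  | m + 1 => sweep l δ (ρ m) (- a m) ++ bwd l δ ρ a m

def U {w : ℕ} (ρ : ℕ → Equiv.Perm (Fin w)) (a : ℕ → ℤ) (D : ℤ) : ℕ → Equiv.Perm (Fin w)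
  | 0 => 1
  | m + 1 => ρ m ^ (a m * D) * U ρ a D m

theorem eval_fwd {ι : Type} {w : ℕ} (z : ι → Bool) (l : List ι) (δ : Bool → ℤ)
    (ρ : ℕ → Equiv.Perm (Fin w)) (a : ℕ → ℤ) (m : ℕ) (R : List (Layer ι w)) (s : Fin w) :
    eval z (fwd l δ ρ a m ++ R) s =
      eval z R (U ρ a (l.map fun i => δ (z i)).sum m s) := by
  induction m generalizing R s with
  | zero => simp [fwd, U]
  | succ m ih =>
    rw [fwd, List.append_assoc, ih, eval_sweep]
    rfl

theorem eval_bwd {ι : Type} {w : ℕ} (z : ι → Bool) (l : List ι) (δ : Bool → ℤ)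
    (ρ : ℕ → Equiv.Perm (Fin w)) (a : ℕ → ℤ) (m : ℕ) (R : List (Layer ι w)) (s : Fin w) :
    eval z (bwd l δ ρ a m ++ R) (U ρ a (l.map fun i => δ (z i)).sum m s) =
      eval z R s := by
  induction m generalizing R s with
  | zero => simp [bwd, U]
  | succ m ih =>
    rw [bwd, List.append_assoc, eval_sweep, ← ih R s]
    congr 1
    rw [← Equiv.Perm.mul_apply, U, ← mul_assoc, ← zpow_add]
    simp

def level {ι : Type} {w : ℕ} (l : List ι) (i0 : ι) (δ : Bool → ℤ) (ρ : ℕ → Equiv.Perm (Fin w))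
    (cls : Fin w → Option Bool) (m : ℕ) (a : ℕ → ℤ) : List (Layer ι w) :=
  fwd l δ ρ a m ++ (⟨i0, fun _ => 1, cls⟩ :: bwd l δ ρ a m)

theorem eval_level {ι : Type} {w : ℕ} (z : ι → Bool) (l : List ι) (i0 : ι) (δ : Bool → ℤ)
    (ρ : ℕ → Equiv.Perm (Fin w)) (cls : Fin w → Option Bool)
    (a : ℕ → ℤ) (m : ℕ) (R : List (Layer ι w)) (s : Fin w) :
    eval z (level l i0 δ ρ cls m a ++ R) s =
      match cls (U ρ a (l.map fun i => δ (z i)).sum m s) with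
      | some b => b
      | none => eval z R s := by
  rw [level, List.append_assoc, eval_fwd, List.cons_append]
  simp only [eval, Equiv.Perm.one_apply]
  rw [eval_bwd]

def prog {ι : Type} {w : ℕ} (l : List ι) (i0 : ι) (δ : Bool → ℤ) (ρ : ℕ → Equiv.Perm (Fin w))
    (cls : Fin w → Option Bool) (m : ℕ) : ℕ → (ℕ → ℤ) → List (Layer ι w)
  | 0, _ => []
  | n + 1, a => level l i0 δ ρ cls m a ++ prog l i0 δ ρ cls m n (fun j => 4 * a j)

def cost {ι : Type} {w : ℕ} (c : ι → ℕ) (L : List (Layer ι w)) : ℕ := (L.map fun x => c x.i).sum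

theorem cost_append {ι : Type} {w : ℕ} (c : ι → ℕ) (L R : List (Layer ι w)) :
    cost c (L ++ R) = cost c L + cost c R := by simp [cost]

theorem cost_sweep {ι : Type} {w : ℕ} (c : ι → ℕ) (l : List ι) (δ : Bool → ℤ)
    (ρ : Equiv.Perm (Fin w)) (n : ℤ) : cost c (sweep l δ ρ n) = (l.map c).sum := by
  simp [cost, sweep, Function.comp_def]

theorem cost_fwd {ι : Type} {w : ℕ} (c : ι → ℕ) (l : List ι) (δ : Bool → ℤ)
    (ρ : ℕ → Equiv.Perm (Fin w)) (a : ℕ → ℤ) (m : ℕ) :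
    cost c (fwd l δ ρ a m) = m * (l.map c).sum := by
  induction m with
  | zero => simp [fwd, cost]
  | succ m ih => rw [fwd, cost_append, ih, cost_sweep]; ring

theorem cost_bwd {ι : Type} {w : ℕ} (c : ι → ℕ) (l : List ι) (δ : Bool → ℤ)
    (ρ : ℕ → Equiv.Perm (Fin w)) (a : ℕ → ℤ) (m : ℕ) :
    cost c (bwd l δ ρ a m) = m * (l.map c).sum := by
  induction m with
  | zero => simp [bwd, cost]
  | succ m ih => rw [bwd, cost_append, ih, cost_sweep]; ring

theorem cost_prog {ι : Type} {w : ℕ} (c : ι → ℕ) (l : List ι) (i0 : ι) (δ : Bool → ℤ)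
    (ρ : ℕ → Equiv.Perm (Fin w)) (cls : Fin w → Option Bool) (m n : ℕ) (a : ℕ → ℤ) :
    cost c (prog l i0 δ ρ cls m n a) = n * (2 * m * (l.map c).sum + c i0) := by
  induction n generalizing a with
  | zero => simp [prog, cost]
  | succ n ih =>
    have h : cost c ((⟨i0, fun _ => 1, cls⟩ : Layer ι w) :: bwd l δ ρ a m) =
        c i0 + cost c (bwd l δ ρ a m) := by simp [cost]
    rw [prog, cost_append, ih, level, cost_append, h, cost_fwd, cost_bwd]
    ring

/-- The cyclic shift of the first `K + j` lines. -/
def rho (w K : ℕ) (j : ℕ) : Equiv.Perm (Fin w) :=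
  if h : K + j - 1 < w then Fin.cycleRange ⟨K + j - 1, h⟩ else 1

theorem cyc {w : ℕ} (i s : Fin w) (hs : s ≤ i) (n : ℤ) :
    (Fin.cycleRange i ^ n) s ≤ i ∧
      ∃ z : ℤ, (((Fin.cycleRange i ^ n) s : Fin w) : ℤ) = s + n + z * ((i : ℤ) + 1) := by
  have one : ∀ t : Fin w, t ≤ i → Fin.cycleRange i t ≤ i ∧
      ∃ z : ℤ, ((Fin.cycleRange i t : Fin w) : ℤ) = t + 1 + z * ((i : ℤ) + 1) := by
    intro t ht
    have : NeZero w := ⟨by have := i.2; omega⟩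
    rcases lt_or_eq_of_le ht with h | h
    · have h1 := Fin.coe_cycleRange_of_lt h
      have h2 : (t : ℕ) < i := h
      refine ⟨?_, 0, ?_⟩
      · rw [Fin.le_def, h1]; omega
      · rw [h1]; push_cast; ring
    · subst h
      rw [Fin.cycleRange_self]
      refine ⟨Fin.zero_le _, -1, ?_⟩
      simp
  induction n using Int.induction_on with
  | zero => exact ⟨by simpa using hs, 0, by simp⟩
  | succ n ih =>
    obtain ⟨h1, z, hz⟩ := ih
    obtain ⟨h2, z', hz'⟩ := one _ h1
    rw [add_comm, zpow_add, zpow_one, Equiv.Perm.mul_apply]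
    refine ⟨h2, z + z', ?_⟩
    rw [hz', hz]; ring
  | pred n ih =>
    obtain ⟨h1, z, hz⟩ := ih
    have e : (Fin.cycleRange i ^ (-(n : ℤ))) s =
        Fin.cycleRange i ((Fin.cycleRange i ^ (-(n : ℤ) - 1)) s) := by
      rw [← Equiv.Perm.mul_apply, ← zpow_one_add]
      congr 2
      ring
    set t := (Fin.cycleRange i ^ (-(n : ℤ) - 1)) s with ht
    have hti : t ≤ i := by
      by_contra hc
      have h3 : Fin.cycleRange i t = t := Fin.cycleRange_of_gt (not_le.mp hc)
      rw [e, h3] at h1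
      exact hc h1
    obtain ⟨h2, z', hz'⟩ := one _ hti
    refine ⟨hti, z - z', ?_⟩
    rw [e] at hz
    rw [hz'] at hz
    linarith

theorem rho_spec (K r : ℕ) (hK : 0 < K) (j : ℕ) (hj : j < r) (s : Fin (K + r))
    (hs : (s : ℕ) < K + j) (n : ℤ) :
    (((rho (K + r) K j ^ n) s : Fin (K + r)) : ℕ) < K + j ∧
      ∃ z : ℤ, (((rho (K + r) K j ^ n) s : Fin (K + r)) : ℤ) = s + n + z * ((K : ℤ) + j) := by
  have h : K + j - 1 < K + r := by omega
  simp only [rho, h, dif_pos]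
  obtain ⟨h1, z, hz⟩ := cyc ⟨K + j - 1, h⟩ s (by rw [Fin.le_def]; simp only; omega) n
  rw [Fin.le_def] at h1
  simp only at h1 hz
  refine ⟨by omega, z, ?_⟩
  rw [hz]
  congr 2
  omega

theorem U_spec (K r : ℕ) (hK : 0 < K) (a : ℕ → ℤ) (D : ℤ) (s0 : Fin (K + r)) (hs0 : (s0 : ℕ) = 0)
    (m : ℕ) (hm : m ≤ r) :
    ((U (rho (K + r) K) a D m s0 : Fin (K + r)) : ℕ) < K + m ∧
    ∃ (z : ℤ) (e : ℝ), 0 ≤ e ∧ e ≤ m / K ∧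
      (((U (rho (K + r) K) a D m s0 : Fin (K + r)) : ℕ) : ℝ) / (K + m) =
        (∑ j ∈ Finset.range m, (a j : ℝ) / (K + j)) * D + z - e := by
  induction m with
  | zero =>
    refine ⟨by simp [U, hs0, hK], 0, 0, le_rfl, by simp, by simp [U, hs0]⟩
  | succ m ih =>
    obtain ⟨h1, z, e, he0, he1, he⟩ := ih (by omega)
    obtain ⟨h2, z', hz'⟩ := rho_spec K r hK m (by omega) (U (rho (K + r) K) a D m s0) h1 (a m * D)
    rw [U, Equiv.Perm.mul_apply]
    set t := U (rho (K + r) K) a D m s0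
    set t' := (rho (K + r) K m ^ (a m * D)) t
    have hKr : (0 : ℝ) < K := by exact_mod_cast hK
    have hQ : (0 : ℝ) < K + m := by positivity
    have hz2 : ((t' : ℕ) : ℝ) = (t : ℕ) + a m * D + z' * (K + m) := by
      exact_mod_cast hz'
    have h2r : ((t' : ℕ) : ℝ) ≤ K + m := by exact_mod_cast h2.le
    refine ⟨by omega, z + z', e + ((t' : ℕ) : ℝ) / ((K + m) * (K + m + 1)), by positivity, ?_, ?_⟩
    · have : ((t' : ℕ) : ℝ) / ((K + m) * (K + m + 1)) ≤ 1 / K := by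
        rw [div_le_div_iff₀ (by positivity) hKr]
        nlinarith [hQ, Nat.cast_nonneg (α := ℝ) m]
      push_cast
      rw [add_div]
      linarith
    · have e1 : ((t' : ℕ) : ℝ) / (K + m) = ((t : ℕ) : ℝ) / (K + m) + a m / (K + m) * D + z' := by
        rw [hz2]; field_simp
      have e2 : ((t' : ℕ) : ℝ) / (K + ((m + 1 : ℕ) : ℝ)) =
          ((t' : ℕ) : ℝ) / (K + m) - ((t' : ℕ) : ℝ) / ((K + m) * (K + m + 1)) := by
        push_cast
        have : (K : ℝ) + (m + 1) ≠ 0 := by positivity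
        have : (K : ℝ) + m + 1 ≠ 0 := by positivity
        field_simp
        ring
      rw [e2, e1, he, Finset.sum_range_succ]
      push_cast
      ring

def cls (w : ℕ) (s : Fin w) : Option Bool :=
  if 0 < (s : ℕ) ∧ 2 * (s : ℕ) < w then some true
  else if (s : ℕ) = 0 ∨ 15 * w ≤ 16 * (s : ℕ) then none else some false

theorem cls_spec (w : ℕ) (s : Fin w) (y e : ℝ) (z : ℤ) (he0 : 0 ≤ e) (he1 : e ≤ 1 / 16)
    (hy : |y| ≤ 1 / 4) (hs : ((s : ℕ) : ℝ) / w = y + z - e) :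
    (cls w s = some true → 0 < y) ∧ (cls w s = some false → y < 0) ∧
      (cls w s = none → |y| ≤ 1 / 16) := by
  have hw : (0 : ℝ) < w := by
    have := s.2
    exact_mod_cast (by omega : 0 < w)
  obtain ⟨hy1, hy2⟩ := abs_le.mp hy
  have hu0 : 0 ≤ ((s : ℕ) : ℝ) / w := by positivity
  have hu1 : ((s : ℕ) : ℝ) / w < 1 := by
    rw [div_lt_one hw]
    exact_mod_cast s.2
  have hz : z = 0 ∨ z = 1 := by
    have h1 : (-1 : ℝ) < z := by linarith
    have h2 : (z : ℝ) < 2 := by linarith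
    have h1' : (-1 : ℤ) < z := by exact_mod_cast h1
    have h2' : z < 2 := by exact_mod_cast h2
    omega
  unfold cls
  split_ifs with h1 h2
  · refine ⟨fun _ => ?_, by simp, by simp⟩
    have a1 : 0 < ((s : ℕ) : ℝ) / w := by
      have : (0 : ℝ) < (s : ℕ) := by exact_mod_cast h1.1
      positivity
    have a2 : ((s : ℕ) : ℝ) / w < 1 / 2 := by
      rw [div_lt_div_iff₀ hw (by norm_num)]
      have : (2 : ℝ) * (s : ℕ) < w := by exact_mod_cast h1.2
      linarith
    rcases hz with rfl | rfl
    · push_cast at hs; linarith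
    · push_cast at hs; linarith
  · refine ⟨by simp, by simp, fun _ => ?_⟩
    rw [abs_le]
    rcases h2 with h2 | h2
    · rw [h2] at hs
      simp only [Nat.cast_zero, zero_div] at hs
      rcases hz with rfl | rfl
      · push_cast at hs; constructor <;> linarith
      · push_cast at hs; linarith
    · have a2 : 15 / 16 ≤ ((s : ℕ) : ℝ) / w := by
        rw [div_le_div_iff₀ (by norm_num) hw]
        have : (15 : ℝ) * w ≤ 16 * (s : ℕ) := by exact_mod_cast h2
        linarith
      rcases hz with rfl | rfl
      · push_cast at hs; linarith
      · push_cast at hs; constructor <;> linarith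
  · refine ⟨by simp, fun _ => ?_, by simp⟩
    push Not at h2
    have a1 : 1 / 2 ≤ ((s : ℕ) : ℝ) / w := by
      rw [div_le_div_iff₀ (by norm_num) hw]
      have : w ≤ 2 * (s : ℕ) := by
        by_contra hc
        exact h1 ⟨by omega, by omega⟩
      have : (w : ℝ) ≤ 2 * (s : ℕ) := by exact_mod_cast this
      linarith
    have a2 : ((s : ℕ) : ℝ) / w < 15 / 16 := by
      rw [div_lt_div_iff₀ hw (by norm_num)]
      have : (16 : ℝ) * (s : ℕ) < 15 * w := by exact_mod_cast h2.2
      linarith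
    rcases hz with rfl | rfl
    · push_cast at hs; linarith
    · push_cast at hs; linarith

theorem prog_correct {ι : Type} (z : ι → Bool) (l : List ι) (i0 : ι) (δ : Bool → ℤ)
    (K r : ℕ) (hK : 0 < K) (hKr : 16 * r ≤ K) (s0 : Fin (K + r)) (hs0 : (s0 : ℕ) = 0) (n : ℕ)
    (a : ℕ → ℤ) (α : ℝ) (hα : α = ∑ j ∈ Finset.range r, (a j : ℝ) / (K + j)) (hpos : 0 < α)
    (D : ℤ) (hD : D = (l.map fun i => δ (z i)).sum) (hb : α * |(D : ℝ)| ≤ 1 / 4)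
    (hn : 1 ≤ α * 4 ^ n) :
    eval z (prog l i0 δ (rho (K + r) K) (cls (K + r)) r n a) s0 = decide (0 ≤ D) := by
  induction n generalizing a α with
  | zero =>
    have h1 : |(D : ℝ)| < 1 := by
      have := abs_nonneg (D : ℝ)
      nlinarith
    have h2 : D = 0 := by
      have h3 : |D| < 1 := by exact_mod_cast h1
      exact Int.abs_lt_one_iff.mp h3
    simp [prog, eval, h2]
  | succ n ih =>
    rw [prog, eval_level, ← hD]
    obtain ⟨-, z', e, he0, he1, he⟩ := U_spec K r hK a D s0 hs0 r le_rfl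
    have hKp : (0 : ℝ) < K := by exact_mod_cast hK
    have he2 : e ≤ 1 / 16 := by
      refine he1.trans ?_
      rw [div_le_div_iff₀ hKp (by norm_num)]
      have : (16 : ℝ) * r ≤ K := by exact_mod_cast hKr
      linarith
    rw [← hα] at he
    have hcast : ((K + r : ℕ) : ℝ) = K + r := by push_cast; ring
    rw [← hcast] at he
    have habs : |α * (D : ℝ)| = α * |(D : ℝ)| := by rw [abs_mul, abs_of_pos hpos]
    obtain ⟨c1, c2, c3⟩ := cls_spec (K + r) _ (α * D) e z' he0 he2 (by rw [habs]; exact hb) he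
    rcases hc : cls (K + r) (U (rho (K + r) K) a D r s0) with _ | b
    · have h3 := c3 hc
      rw [habs] at h3
      simp only
      refine ih (fun j => 4 * a j) (4 * α) ?_ (by positivity) ?_ ?_
      · rw [hα, Finset.mul_sum]
        refine Finset.sum_congr rfl fun j _ => ?_
        push_cast
        ring
      · linarith
      · rw [pow_succ] at hn
        linarith
    · cases b
      · have h3 := c2 hc
        have h4 : (D : ℝ) < 0 := by
          by_contra hcon
          push Not at hcon
          have := mul_nonneg hpos.le hcon
          linarith
        have h5 : D < 0 := by exact_mod_cast h4
        simp [h5]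
      · have h3 := c1 hc
        have h4 : (0 : ℝ) < D := by
          by_contra hcon
          push Not at hcon
          nlinarith
        have h5 : 0 < D := by exact_mod_cast h4
        simp [h5.le]

theorem coefs (q : ℕ) : ∀ K : ℕ, 0 < K → ∃ a : ℕ → ℤ,
    ∑ j ∈ Finset.range (q + 1), (a j : ℝ) / (K + j) =
      (q.factorial : ℝ) / ∏ j ∈ Finset.range (q + 1), ((K : ℝ) + j) := by
  induction q with
  | zero => intro K hK; exact ⟨fun _ => 1, by simp⟩
  | succ q ih =>
    intro K hK
    obtain ⟨a, ha⟩ := ih K hK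
    obtain ⟨b, hb⟩ := ih (K + 1) (by omega)
    have hKp : (0 : ℝ) < K := by exact_mod_cast hK
    refine ⟨fun j => (if j = q + 1 then 0 else a j) - (if j = 0 then 0 else b (j - 1)), ?_⟩
    have e1 : ∑ j ∈ Finset.range (q + 1 + 1),
        ((if j = q + 1 then 0 else a j : ℤ) : ℝ) / (K + j) =
        (q.factorial : ℝ) / ∏ j ∈ Finset.range (q + 1), ((K : ℝ) + j) := by
      rw [Finset.sum_range_succ, ← ha]
      simp only [if_true, Int.cast_zero, zero_div, add_zero]
      refine Finset.sum_congr rfl fun j hj => ?_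
      have : j ≠ q + 1 := by
        have := Finset.mem_range.mp hj
        omega
      simp [this]
    have e2 : ∑ j ∈ Finset.range (q + 1 + 1),
        ((if j = 0 then 0 else b (j - 1) : ℤ) : ℝ) / (K + j) =
        (q.factorial : ℝ) / ∏ j ∈ Finset.range (q + 1), (((K + 1 : ℕ) : ℝ) + j) := by
      rw [Finset.sum_range_succ', ← hb]
      simp only [if_true, Int.cast_zero, zero_div, add_zero]
      refine Finset.sum_congr rfl fun j hj => ?_
      simp only [Nat.succ_ne_zero, if_false, Nat.add_sub_cancel]
      push_cast
      congr 1
      ring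
    have e3 : ∀ j : ℕ, (((if j = q + 1 then 0 else a j) - (if j = 0 then 0 else b (j - 1)) : ℤ) : ℝ)
        / ((K : ℝ) + j) = ((if j = q + 1 then 0 else a j : ℤ) : ℝ) / (K + j) -
          ((if j = 0 then 0 else b (j - 1) : ℤ) : ℝ) / (K + j) := by
      intro j
      rw [Int.cast_sub, sub_div]
    rw [Finset.sum_congr rfl fun j _ => e3 j, Finset.sum_sub_distrib, e1, e2]
    set Q := ∏ j ∈ Finset.range q, ((K : ℝ) + (j + 1)) with hQ
    have hQp : 0 < Q := Finset.prod_pos fun j _ => by positivity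
    have p1 : ∏ j ∈ Finset.range (q + 1), ((K : ℝ) + j) = Q * K := by
      rw [Finset.prod_range_succ']
      simp [hQ]
    have p2 : ∏ j ∈ Finset.range (q + 1), (((K + 1 : ℕ) : ℝ) + j) = Q * (K + 1 + q) := by
      rw [Finset.prod_range_succ]
      congr 1
      · refine Finset.prod_congr rfl fun j _ => ?_
        push_cast
        ring
      · push_cast
        ring
    have p3 : ∏ j ∈ Finset.range (q + 1 + 1), ((K : ℝ) + j) = Q * K * (K + 1 + q) := by
      rw [Finset.prod_range_succ, p1]
      push_cast
      ring
    rw [p1, p2, p3, Nat.factorial_succ]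
    have : (K : ℝ) + 1 + q ≠ 0 := by positivity
    push_cast
    field_simp
    ring

theorem prod_lower (q K : ℕ) (hK : 16 * (q + 1) ≤ K) :
    (16 : ℝ) ^ (q + 1) * q.factorial ≤ ∏ j ∈ Finset.range (q + 1), ((K : ℝ) + j) := by
  have h : ∀ m ≤ q, (16 : ℝ) ^ m * m.factorial ≤ ∏ j ∈ Finset.range m, ((K : ℝ) + (j + 1)) := by
    intro m
    induction m with
    | zero => simp
    | succ m ih =>
      intro hm
      rw [Finset.prod_range_succ, pow_succ, Nat.factorial_succ]
      have h1 := ih (by omega)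
      have h2 : (16 : ℝ) * (m + 1) ≤ K + (m + 1) := by
        have : (16 * (m + 1) : ℕ) ≤ K + (m + 1) := by omega
        exact_mod_cast this
      calc (16 : ℝ) ^ m * 16 * ((m + 1) * m.factorial : ℕ)
          = (16 ^ m * m.factorial) * (16 * (m + 1)) := by push_cast; ring
        _ ≤ _ := mul_le_mul h1 h2 (by positivity) (Finset.prod_nonneg fun j _ => by positivity)
  rw [Finset.prod_range_succ']
  have h1 := h q le_rfl
  have h2 : (16 : ℝ) ≤ K := by exact_mod_cast (by omega : 16 ≤ K)
  calc (16 : ℝ) ^ (q + 1) * q.factorial = (16 ^ q * q.factorial) * 16 := by ring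
    _ ≤ (∏ j ∈ Finset.range q, ((K : ℝ) + (j + 1))) * K :=
        mul_le_mul h1 h2 (by norm_num) (Finset.prod_nonneg fun j _ => by positivity)
    _ = _ := by simp

theorem prod_upper (q K : ℕ) (hK : 0 < K) :
    ∏ j ∈ Finset.range (q + 1), ((K : ℝ) + j) ≤ 4 ^ (K + (q + 1)) * q.factorial := by
  obtain ⟨n, rfl⟩ : ∃ n, K = n + 1 := ⟨K - 1, by omega⟩
  have h1 : ∏ j ∈ Finset.range (q + 1), (n + 1 + j) =
      (q + 1).factorial * (n + (q + 1)).choose (q + 1) := by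
    rw [← Nat.ascFactorial_eq_prod_range, Nat.ascFactorial_eq_factorial_mul_choose]
  have h2 : (n + (q + 1)).choose (q + 1) ≤ 2 ^ (n + (q + 1)) := Nat.choose_le_two_pow _ _
  have h3 : q + 1 ≤ 2 ^ (q + 1) := Nat.lt_two_pow_self.le
  have h4 : ∏ j ∈ Finset.range (q + 1), (n + 1 + j) ≤ 4 ^ (n + 1 + (q + 1)) * q.factorial := by
    rw [h1, Nat.factorial_succ]
    have h5 : 2 ^ (q + 1) * 2 ^ (n + (q + 1)) ≤ 4 ^ (n + 1 + (q + 1)) := by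
      rw [show (4 : ℕ) = 2 ^ 2 by norm_num, ← pow_mul, ← pow_add]
      exact Nat.pow_le_pow_right (by norm_num) (by omega)
    calc (q + 1) * q.factorial * (n + (q + 1)).choose (q + 1)
        = ((q + 1) * (n + (q + 1)).choose (q + 1)) * q.factorial := by ring
      _ ≤ (2 ^ (q + 1) * 2 ^ (n + (q + 1))) * q.factorial :=
          Nat.mul_le_mul_right _ (Nat.mul_le_mul h3 h2)
      _ ≤ _ := Nat.mul_le_mul_right _ h5
  have h6 : ((∏ j ∈ Finset.range (q + 1), (n + 1 + j) : ℕ) : ℝ) ≤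
      ((4 ^ (n + 1 + (q + 1)) * q.factorial : ℕ) : ℝ) := by exact_mod_cast h4
  push_cast at h6 ⊢
  exact h6

theorem core {X Y ι : Type} [Fintype ι] (i0 : ι) (c : ι → ℕ) (hc : ∀ i, 0 < c i)
    (f : ι → X → Y → Bool)
    (hP : ∀ i, ∃ P : GHProtocol X Y (c i), P.Computes (f i)) (k : ℕ) (hk : Fintype.card ι ≤ k) :
    ∃ s ≤ 4335 * ((∑ i, c i) * (Nat.log 2 k + 1) ^ 3 + 1),
      ∃ P : GHProtocol X Y s, P.Computes (fun x y =>
        decide (k ≤ 2 * (Finset.univ.filter fun i => f i x y = true).card)) := by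
  classical
  set q := Nat.log 2 k with hq
  set r := q + 1 with hr
  set K := 16 * r with hKdef
  have hK : 0 < K := by omega
  obtain ⟨a, ha⟩ := coefs q K hK
  set δ : Bool → ℤ := fun b => (if b = true then 2 * (Fintype.card ι : ℤ) else 0) - k with hδ
  set l := (Finset.univ : Finset ι).toList with hl
  let s0 : Fin (K + r) := ⟨0, by omega⟩
  set L := prog l i0 δ (rho (K + r) K) (cls (K + r)) r (K + r) a with hL
  have hcard : 0 < Fintype.card ι := Fintype.card_pos_iff.mpr ⟨i0⟩
  set α : ℝ := (q.factorial : ℝ) / ∏ j ∈ Finset.range (q + 1), ((K : ℝ) + j) with hα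
  have hprod : 0 < ∏ j ∈ Finset.range (q + 1), ((K : ℝ) + j) :=
    Finset.prod_pos fun j _ => by positivity
  have hfac : (0 : ℝ) < q.factorial := by exact_mod_cast q.factorial_pos
  have hαp : 0 < α := by positivity
  -- correctness
  have hcorr : ∀ x y, eval (fun i => f i x y) L s0 =
      decide (k ≤ 2 * (Finset.univ.filter fun i => f i x y = true).card) := by
    intro x y
    set N := (Finset.univ.filter fun i => f i x y = true).card with hN
    have hD : ((Fintype.card ι : ℤ) * (2 * N - k)) = (l.map fun i => δ (f i x y)).sum := by
      rw [hl, Finset.sum_map_toList]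
      simp only [hδ]
      rw [Finset.sum_sub_distrib, ← Finset.sum_filter]
      simp
      ring
    have hNk : N ≤ Fintype.card ι := Finset.card_le_univ _
    have hDk : |((Fintype.card ι : ℤ) * (2 * N - k) : ℤ)| ≤ k * k := by
      rw [abs_mul, Nat.abs_cast]
      have h1 : |(2 * (N : ℤ) - k)| ≤ k := by
        rw [abs_le]; constructor <;> omega
      exact mul_le_mul (by exact_mod_cast hk) h1 (abs_nonneg _) (by positivity)
    have hb : α * |(((Fintype.card ι : ℤ) * (2 * N - k) : ℤ) : ℝ)| ≤ 1 / 4 := by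
      have h1 : |(((Fintype.card ι : ℤ) * (2 * N - k) : ℤ) : ℝ)| ≤ k * k := by
        exact_mod_cast hDk
      have h2 : k < 2 ^ (q + 1) := Nat.lt_pow_succ_log_self (by norm_num) k
      have h3 : 4 * (k * k) ≤ 16 ^ (q + 1) := by
        have h4 : k * k ≤ 2 ^ (q + 1) * 2 ^ (q + 1) := Nat.mul_le_mul h2.le h2.le
        have h5 : (16 : ℕ) ^ (q + 1) = 4 ^ (q + 1) * (2 ^ (q + 1) * 2 ^ (q + 1)) := by
          rw [← mul_pow, ← mul_pow]; norm_num
        have h6 : 4 ≤ 4 ^ (q + 1) := by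
          rw [pow_succ]; have := Nat.one_le_pow q 4 (by norm_num); omega
        rw [h5]
        exact Nat.mul_le_mul h6 h4
      have h3' : (4 : ℝ) * (k * k) ≤ 16 ^ (q + 1) := by exact_mod_cast h3
      have h7 := prod_lower q K le_rfl
      have h8 : α * 16 ^ (q + 1) ≤ 1 := by
        rw [hα, div_mul_eq_mul_div, div_le_one hprod]
        linarith
      have h9 : α * |(((Fintype.card ι : ℤ) * (2 * N - k) : ℤ) : ℝ)| ≤ α * (k * k) :=
        mul_le_mul_of_nonneg_left h1 hαp.le
      have h10 : α * (4 * (k * k)) ≤ α * 16 ^ (q + 1) := mul_le_mul_of_nonneg_left h3' hαp.le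
      linarith
    have hn : 1 ≤ α * 4 ^ (K + r) := by
      rw [hα, div_mul_eq_mul_div, one_le_div hprod]
      have := prod_upper q K hK
      linarith
    rw [hL, prog_correct (fun i => f i x y) l i0 δ K r hK le_rfl s0 rfl (K + r) a α
      ha.symm hαp _ hD hb hn]
    rw [decide_eq_decide]
    have hcz : (0 : ℤ) < Fintype.card ι := by exact_mod_cast hcard
    constructor
    · intro h
      have := nonneg_of_mul_nonneg_right h hcz
      omega
    · intro h
      exact mul_nonneg hcz.le (by omega)
  -- size
  have hcost : cost c L = (K + r) * (2 * r * (∑ i, c i) + c i0) := by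
    rw [hL, cost_prog, hl, Finset.sum_map_toList]
  have hlen : L.length ≤ cost c L := by
    unfold cost
    have := List.length_le_sum_of_one_le (L.map fun x => c x.i) (by
      intro n hn
      obtain ⟨x, -, rfl⟩ := List.mem_map.mp hn
      exact hc _)
    simpa using this
  have hsum : ∑ τ : Fin L.length, (c (L.get τ).i + 1) = cost c L + L.length := by
    rw [Finset.sum_add_distrib]
    simp only [Finset.sum_const, Finset.card_univ, Fintype.card_fin, smul_eq_mul, mul_one]
    congr 1
    unfold cost
    rw [← Fin.sum_univ_fun_getElem]
    rfl
  have hpos : 0 < L.length := by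
    rw [List.length_pos_iff]
    intro h
    have : cost c L = 0 := by rw [h]; rfl
    rw [hcost] at this
    have h1 := hc i0
    have h2 : 0 < (K + r) * (2 * r * (∑ i, c i) + c i0) := by positivity
    omega
  obtain ⟨P, hPc⟩ := gh_of_program c f hP L s0 hpos
  refine ⟨_, ?_, P, ?_⟩
  · rw [hsum]
    have hi0 : c i0 ≤ ∑ i, c i := Finset.single_le_sum (fun _ _ => Nat.zero_le _) (Finset.mem_univ i0)
    set S := ∑ i, c i with hS
    have h1 : cost c L ≤ 17 * r * (3 * r * S) := by
      rw [hcost]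
      have e1 : K + r = 17 * r := by omega
      rw [e1]
      refine Nat.mul_le_mul_left _ ?_
      have : S ≤ r * S := Nat.le_mul_of_pos_left _ (by omega)
      nlinarith
    have e1 : K + r = 17 * r := by omega
    have hfin : ∀ (len cst W : ℕ), W = 17 * r → len ≤ cst → cst ≤ 17 * r * (3 * r * S) →
        1 + (len * W + 2 * (W * (cst + len))) ≤ 4335 * (S * r ^ 3 + 1) := by
      rintro len cst W rfl hlc hcs
      have h2 : len * (17 * r) ≤ cst * (17 * r) := Nat.mul_le_mul_right _ hlc
      have h3 : 17 * r * (cst + len) ≤ 17 * r * (2 * cst) :=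
        Nat.mul_le_mul_left _ (by omega)
      have h4 : 17 * r * cst ≤ 17 * r * (17 * r * (3 * r * S)) := Nat.mul_le_mul_left _ hcs
      have h5 : 17 * r * (17 * r * (3 * r * S)) * 5 = 4335 * (S * r ^ 3) := by ring
      linarith
    exact hfin _ _ _ e1 hlen h1
  · have : (fun x y => eval (fun i => f i x y) L s0) = (fun x y =>
        decide (k ≤ 2 * (Finset.univ.filter fun i => f i x y = true).card)) := by
      funext x y
      exact hcorr x y
    rw [← this]
    exact hPc

theorem const_true (X Y : Type) : ∃ P : GHProtocol X Y 1, P.Computes (fun _ _ => true) := by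
  have := build (X := X) (Y := Y) (V := Unit)
    (fun _ v => match v with | none => some () | some _ => none) (fun _ v => v)
    (by intro x v; rcases v with _ | _ <;> rfl) (by intro y v; rfl) (fun _ _ => true)
    (by
      intro x y
      refine ⟨some (), Relation.ReflTransGen.single ?_, ?_⟩
      · simp [Rel, stp]
      · simp [stp])
  simpa using this

theorem const_false (X Y : Type) : ∃ P : GHProtocol X Y 0, P.Computes (fun _ _ => false) := by
  have := build (X := X) (Y := Y) (V := Empty)
    (fun _ v => v) (fun _ v => v)
    (by intro x v; rfl) (by intro y v; rfl) (fun _ _ => false)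
    (by
      intro x y
      refine ⟨none, Relation.ReflTransGen.refl, ?_⟩
      simp [stp])
  have e : Fintype.card Empty = 0 := rfl
  rw [e] at this
  exact this

theorem false_of_zero {X Y : Type} {s : ℕ} (hs : s = 0) (f : X → Y → Bool) (P : GHProtocol X Y s)
    (h : P.Computes f) (x : X) (y : Y) : f x y = false := by
  subst hs
  have h2 := (h x y).2
  have : ghLen (P.A x) (P.B y) = 0 := by
    unfold ghLen
    refine Nat.sInf_eq_zero.mpr (Or.inl ?_)
    exact Subsingleton.elim _ _
  rw [this] at h2
  simpa using h2

end GHMaj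

/-- If `f₁, …, f_k` have garden-hose complexities `c₁, …, c_k` (their inputs may
be distributed arbitrarily between Alice and Bob), then
`GH(MAJ(f₁, …, f_k)) = O((Σᵢ cᵢ) · log³ k)`, where `MAJ(z₁, …, z_k) = 1` iff
`Σᵢ zᵢ ≥ k/2`. -/
theorem GH_compose_majority :
    ∃ C : ℕ, 0 < C ∧
      ∀ (X Y : Type) (k : ℕ) (f : Fin k → X → Y → Bool) (c : Fin k → ℕ),
        (∀ i, ∃ P : GHProtocol X Y (c i), P.Computes (f i)) →
        ∃ s ≤ C * ((∑ i, c i) * (Nat.log 2 k + 1) ^ 3 + 1),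
          ∃ P : GHProtocol X Y s,
            P.Computes (fun x y =>
              decide (k ≤ 2 * (Finset.univ.filter fun i => f i x y = true).card)) := by
  classical
  refine ⟨4335, by norm_num, ?_⟩
  intro X Y k f c h
  have hfalse : ∀ i, c i = 0 → ∀ x y, f i x y = false := by
    intro i hi x y
    obtain ⟨P, hP⟩ := h i
    exact GHMaj.false_of_zero hi _ P hP x y
  by_cases hex : ∃ i, c i ≠ 0
  · obtain ⟨i0, hi0⟩ := hex
    obtain ⟨s, hs, P, hP⟩ := GHMaj.core (X := X) (Y := Y) (ι := {i : Fin k // c i ≠ 0}) ⟨i0, hi0⟩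
      (fun i => c i.1) (fun i => Nat.pos_of_ne_zero i.2) (fun i => f i.1) (fun i => h i.1) k
      (by simpa using Fintype.card_subtype_le (fun i : Fin k => c i ≠ 0))
    refine ⟨s, hs.trans ?_, P, ?_⟩
    · have h1 : ∑ i : {i : Fin k // c i ≠ 0}, c i.1 ≤ ∑ i, c i := by
        rw [← Finset.sum_subtype (Finset.univ.filter fun i : Fin k => c i ≠ 0) (by simp) c]
        exact Finset.sum_le_sum_of_subset (Finset.filter_subset _ _)
      gcongr
    · have hfun : (fun x y =>
          decide (k ≤ 2 * (Finset.univ.filter fun i => f i x y = true).card)) = (fun x y =>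
          decide (k ≤ 2 * (Finset.univ.filter
            fun i : {i : Fin k // c i ≠ 0} => f i.1 x y = true).card)) := by
        funext x y
        have hc : (Finset.univ.filter fun i => f i x y = true) =
            (Finset.univ.filter fun i : {i : Fin k // c i ≠ 0} => f i.1 x y = true).map
              (Function.Embedding.subtype _) := by
          ext i
          simp only [Finset.mem_filter, Finset.mem_univ, true_and, Finset.mem_map,
            Function.Embedding.subtype_apply, Subtype.exists, exists_and_right, exists_eq_right]
          constructor
          · intro hi
            have hci : c i ≠ 0 := fun h0 => by simp [hfalse i h0 x y] at hi
            exact ⟨hci, hi⟩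
          · rintro ⟨_, hj⟩
            exact hj
        rw [hc, Finset.card_map]
      rw [hfun]
      exact hP
  · push Not at hex
    have hcount : ∀ x y, (Finset.univ.filter fun i => f i x y = true).card = 0 := by
      intro x y
      rw [Finset.card_eq_zero, Finset.filter_eq_empty_iff]
      intro i _
      simp [hfalse i (hex i) x y]
    by_cases hk : k = 0
    · refine ⟨1, by omega, ?_⟩
      simp only [hcount]
      simpa [hk] using GHMaj.const_true X Y
    · refine ⟨0, by omega, ?_⟩
      simp only [hcount]
      simpa [hk] using GHMaj.const_false X Y
end
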